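/- arXiv:2412.00917 — 5 statements merged into one kernel-verified Lean document; each statement's English description precedes it below -/
import Mathlib

section
/- For every positive integer r there is a constant J > 0 with the following property. Let V be a finite set and let F ⊆ 2^V be an increasing family. If for some p ∈ (0,1] the family F is weakly (Jp, r)-small, then F is p-small. -/
open Finset

/-- `F` is an increasing family of subsets of `V`. -/
def Increasing {V : Type*} [DecidableEq V] (F : Finset (Finset V)) : Prop :=
  ∀ A ∈ F, ∀ B, A ⊆ B → B ∈ F

/-- `F` is `p`-small: there is `G` such that every member of `F` contains a member of `G`
and `∑_{S ∈ G} p^{|S|} ≤ 1/2`. -/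
def PSmall {V : Type*} [DecidableEq V] (F : Finset (Finset V)) (p : ℝ) : Prop :=
  ∃ G : Finset (Finset V),
    (∀ I ∈ F, ∃ S ∈ G, S ⊆ I) ∧ ∑ S ∈ G, p ^ S.card ≤ 1 / 2

/-- `F` is weakly `(p, r)`-small: there is `λ : 2^V → [0,∞)` supported on sets of size
at most `r` with `∑_{S ⊆ I} λ S ≥ 1` for all `I ∈ F` and `∑_S λ S p^{|S|} ≤ 1/2`. -/
def WeaklyPRSmall {V : Type*} [Fintype V] [DecidableEq V]
    (F : Finset (Finset V)) (p : ℝ) (r : ℕ) : Prop :=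
  ∃ lam : Finset V → ℝ,
    (∀ S, 0 ≤ lam S) ∧
    (∀ S : Finset V, r < S.card → lam S = 0) ∧
    (∀ I ∈ F, 1 ≤ ∑ S ∈ I.powerset, lam S) ∧
    ∑ S ∈ (Finset.univ : Finset V).powerset, lam S * p ^ S.card ≤ 1 / 2

/-- `D` maximises `g D' - c * #D'` among the subsets of `Z`, with ties broken in favour of larger
sets. -/
def IsPenalizedMax {V : Type*} [DecidableEq V] (g : Finset V → ℝ) (c : ℝ) (Z D : Finset V) : Prop :=
  D ⊆ Z ∧ ∀ D' ⊆ Z, g D' - c * #D' ≤ g D - c * #D ∧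
    (g D - c * #D ≤ g D' - c * #D' → #D' ≤ #D)

section PenalizedMax

variable {V : Type*} [DecidableEq V] {g : Finset V → ℝ} {c c' : ℝ} {Z W D D' : Finset V}

theorem exists_isPenalizedMax (g : Finset V → ℝ) (c : ℝ) (Z : Finset V) :
    ∃ D, IsPenalizedMax g c Z D := by
  obtain ⟨D, hD, hmax⟩ := Z.powerset.exists_max_image
    (fun D => toLex (g D - c * (#D : ℝ), #D)) ⟨∅, by simp⟩
  refine ⟨D, by simpa using hD, fun D' hD' => ?_⟩
  have h := hmax D' (by simpa using hD')
  rw [Prod.Lex.toLex_le_toLex] at h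
  rcases h with h | ⟨h, h'⟩
  · exact ⟨h.le, fun h2 => absurd h (not_lt.2 h2)⟩
  · exact ⟨h.le, fun _ => h'⟩

theorem IsPenalizedMax.mono (h : IsPenalizedMax g c Z D) {Z' : Finset V} (hZ : Z' ⊆ Z)
    (hD : D ⊆ Z') : IsPenalizedMax g c Z' D :=
  ⟨hD, fun D' hD' => h.2 D' (hD'.trans hZ)⟩

theorem IsPenalizedMax.anti (hg : ∀ A B, g A + g B ≤ g (A ∪ B) + g (A ∩ B))
    (h : IsPenalizedMax g c Z D) (h' : IsPenalizedMax g c' Z D') (hc : c ≤ c') : D' ⊆ D := by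
  have hu := (h.2 (D ∪ D') (union_subset h.1 h'.1)).2
  have hi := (h'.2 (D ∩ D') (inter_subset_left.trans h.1)).1
  have hs := hg D D'
  have hcard : (#(D ∪ D') : ℝ) + #(D ∩ D') = #D + #D' := by
    exact_mod_cast card_union_add_card_inter D D'
  have hle : (#(D ∩ D') : ℝ) ≤ #D' := by exact_mod_cast card_le_card inter_subset_right
  have hmul : c * (#(D ∪ D') : ℝ) + c * #(D ∩ D') = c * #D + c * #D' := by
    rw [← mul_add, hcard, mul_add]
  have hprod := mul_nonneg (sub_nonneg.2 hc) (sub_nonneg.2 hle)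
  have hcard' : #(D ∪ D') ≤ #D := hu (by linarith)
  have := eq_of_subset_of_card_le (subset_union_left (s₁ := D) (s₂ := D')) hcard'
  rw [this]
  exact subset_union_right

theorem IsPenalizedMax.eq_of_card_eq (hg : ∀ A B, g A + g B ≤ g (A ∪ B) + g (A ∩ B))
    (h : IsPenalizedMax g c Z D) (h' : IsPenalizedMax g c' Z D') (hcard : #D = #D') : D = D' := by
  rcases le_total c c' with hc | hc
  · exact (eq_of_subset_of_card_le (h.anti hg h' hc) hcard.le).symm
  · exact eq_of_subset_of_card_le (h'.anti hg h hc) hcard.ge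

/-- Halving the penalty propagates the bound on penalized maximisers, provided that each of them
is empty or has the majority of its elements in `W`. -/
theorem penalizedMax_bound_half (hg : ∀ A B, g A + g B ≤ g (A ∪ B) + g (A ∩ B)) (hc : 0 < c)
    (hbad : ∀ D, IsPenalizedMax g (2 * c) Z D → #D ≤ 2 * #(W ∩ D))
    (ih : ∀ D, IsPenalizedMax g (2 * c) Z D →
      g D - g ∅ - 4 * (g D - g (D \ W)) ≤ 2 * c * (2 * #D - 4 * #(W ∩ D)))
    (hD : IsPenalizedMax g c Z D) :
    g D - g ∅ - 4 * (g D - g (D \ W)) ≤ c * (2 * #D - 4 * #(W ∩ D)) := by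
  obtain ⟨E, hE⟩ := exists_isPenalizedMax g (2 * c) Z
  have hED : E ⊆ D := hD.anti hg hE (by linarith)
  have h1 := ih E hE
  have h2 : (#E : ℝ) ≤ 2 * #(W ∩ E) := by exact_mod_cast hbad E hE
  have h3 := (hE.2 D hD.1).1
  have h4 := (hD.2 ((D \ W) ∪ E) (union_subset (sdiff_subset.trans hD.1) hE.1)).1
  have h5 := hg (D \ W) E
  have h6 : (D \ W) ∩ E = E \ W := by
    ext x; simp only [mem_inter, mem_sdiff]; have := @hED x; tauto
  have h7 : (#((D \ W) ∪ E) : ℝ) = #D - #(W ∩ D) + #(W ∩ E) := by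
    have a1 := card_union_add_card_inter (D \ W) E
    have a2 := card_sdiff_add_card_inter D W
    have a3 := card_sdiff_add_card_inter E W
    rw [inter_comm] at a2 a3
    rw [h6] at a1
    have a1' : (#((D \ W) ∪ E) : ℝ) + #(E \ W) = #(D \ W) + #E := by exact_mod_cast a1
    have a2' : (#(D \ W) : ℝ) + #(W ∩ D) = #D := by exact_mod_cast a2
    have a3' : (#(E \ W) : ℝ) + #(W ∩ E) = #E := by exact_mod_cast a3
    linarith
  rw [h6] at h5
  rw [h7] at h4
  nlinarith

/-- If a monotone supermodular function loses little of its value when `W` is removed, then some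
penalized maximiser is nonempty and has at least half of its elements outside `W`. -/
theorem exists_isPenalizedMax_inter_le (hg : ∀ A B, g A + g B ≤ g (A ∪ B) + g (A ∩ B))
    (hmono : Monotone g) (h : 4 * (g Z - g (Z \ W)) < g Z - g ∅) :
    ∃ c D, IsPenalizedMax g c Z D ∧ D.Nonempty ∧ 2 * #(W ∩ D) ≤ #D := by
  by_contra! hcon
  have hbad : ∀ c D, IsPenalizedMax g c Z D → #D ≤ 2 * #(W ∩ D) := by
    intro c D hD
    rcases D.eq_empty_or_nonempty with rfl | hne
    · simp
    · exact (hcon c D hD hne).le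
  set M : ℝ := g Z - g ∅ + 1 with hM
  have hMpos : 0 < M := by have := hmono (empty_subset Z); linarith
  have key : ∀ n : ℕ, ∀ D, IsPenalizedMax g (M / 2 ^ n) Z D →
      g D - g ∅ - 4 * (g D - g (D \ W)) ≤ M / 2 ^ n * (2 * #D - 4 * #(W ∩ D)) := by
    intro n
    induction n with
    | zero =>
      intro D hD
      have h0 := (hD.2 ∅ (empty_subset _)).1
      have hDZ := hmono hD.1
      rcases D.eq_empty_or_nonempty with rfl | hne
      · simp
      · have : (1 : ℝ) ≤ #D := by exact_mod_cast hne.card_pos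
        simp only [card_empty, Nat.cast_zero, mul_zero, sub_zero, pow_zero, div_one] at h0
        have hDZ' : g D ≤ g Z := hDZ
        nlinarith
    | succ n ih =>
      intro D hD
      have h2 : 2 * (M / 2 ^ (n + 1)) = M / 2 ^ n := by rw [pow_succ]; field_simp
      refine penalizedMax_bound_half hg (by positivity) ?_ ?_ hD
      · intro D hD
        exact hbad _ D hD
      · rw [h2]; exact ih
  set gap : ℝ := g Z - g ∅ - 4 * (g Z - g (Z \ W)) with hgap
  have hgap0 : 0 < gap := by linarith
  obtain ⟨n, hn⟩ := exists_nat_gt (M * #Z / gap)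
  have hn2 : M / 2 ^ n * #Z < gap := by
    have : (n : ℝ) < 2 ^ n := by exact_mod_cast Nat.lt_two_pow_self
    rw [div_lt_iff₀ hgap0] at hn
    rw [div_mul_eq_mul_div, div_lt_iff₀ (by positivity)]
    nlinarith
  obtain ⟨D, hD⟩ := exists_isPenalizedMax g (M / 2 ^ n) Z
  have h1 := key n D hD
  have h2 := (hD.2 Z subset_rfl).1
  have h3 : (#D : ℝ) ≤ 2 * #(W ∩ D) := by exact_mod_cast hbad _ D hD
  have h4 := hg D (Z \ W)
  have h5 : D ∩ (Z \ W) = D \ W := by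
    ext x; simp only [mem_inter, mem_sdiff]; have := @hD.1 x; tauto
  have h6 : g (D ∪ (Z \ W)) ≤ g Z := hmono (union_subset hD.1 sdiff_subset)
  have h7 : 0 < M / 2 ^ n := by positivity
  have h8 : (0 : ℝ) ≤ #D := by positivity
  rw [h5] at h4
  nlinarith

end PenalizedMax

/-- The probability that a random subset containing each element independently with
probability `q` is equal to `W`. -/
noncomputable def bernoulliWeight {V : Type*} [Fintype V] [DecidableEq V] (q : ℝ)
    (W : Finset V) : ℝ :=
  q ^ #W * (1 - q) ^ #Wᶜ

section Bernoulli

variable {V : Type*} [Fintype V] [DecidableEq V] {q : ℝ}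

theorem bernoulliWeight_nonneg (h0 : 0 ≤ q) (h1 : q ≤ 1) (W : Finset V) :
    0 ≤ bernoulliWeight q W :=
  mul_nonneg (pow_nonneg h0 _) (pow_nonneg (sub_nonneg.2 h1) _)

theorem sum_bernoulliWeight_superset (q : ℝ) (A : Finset V) :
    ∑ W, (if A ⊆ W then bernoulliWeight q W else 0) = q ^ #A := by
  have h := Finset.prod_add (fun _ : V => q) (fun v => if v ∈ A then 0 else 1 - q) univ
  have hl : ∏ v, (q + if v ∈ A then 0 else 1 - q) = q ^ #A := by
    have : ∀ v ∈ univ, (q + if v ∈ A then 0 else 1 - q) = if v ∈ A then q else 1 := by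
      intro v _
      split_ifs <;> ring
    rw [prod_congr rfl this, prod_ite_mem, univ_inter, prod_const]
  rw [← hl, h, powerset_univ]
  refine sum_congr rfl fun W _ => ?_
  rw [prod_const, ← compl_eq_univ_sdiff]
  split_ifs with hA
  · rw [bernoulliWeight, ← prod_const (s := Wᶜ)]
    congr 1
    refine prod_congr rfl fun v hv => ?_
    rw [if_neg fun hvA => (mem_compl.1 hv) (hA hvA)]
  · obtain ⟨v, hvA, hvW⟩ := not_subset.1 hA
    rw [prod_eq_zero (mem_compl.2 hvW) (by simp [hvA]), mul_zero]

theorem sum_bernoulliWeight (q : ℝ) : ∑ W : Finset V, bernoulliWeight q W = 1 := by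
  simpa using sum_bernoulliWeight_superset q (∅ : Finset V)

theorem bernoulliWeight_mul_pow_le {p x : ℝ} (h0 : 0 ≤ q) (h1 : q ≤ 1) (hp : p = x * q)
    (hx : 0 ≤ x) {W T : Finset V} (hWT : Disjoint W T) :
    bernoulliWeight q W * p ^ #T ≤ bernoulliWeight q (W ∪ T) * x ^ #T := by
  have hle : #(W ∪ T)ᶜ ≤ #Wᶜ := card_le_card (compl_subset_compl.2 subset_union_left)
  have hpow : (1 - q) ^ #Wᶜ ≤ (1 - q) ^ #(W ∪ T)ᶜ :=
    pow_le_pow_of_le_one (by linarith) (by linarith) hle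
  rw [bernoulliWeight, bernoulliWeight, hp, card_union_of_disjoint hWT, pow_add, mul_pow]
  calc q ^ #W * (1 - q) ^ #Wᶜ * (x ^ #T * q ^ #T)
      = q ^ #W * q ^ #T * x ^ #T * (1 - q) ^ #Wᶜ := by ring
    _ ≤ q ^ #W * q ^ #T * x ^ #T * (1 - q) ^ #(W ∪ T)ᶜ := by gcongr
    _ = _ := by ring

end Bernoulli

section Fragments

variable {V : Type*} [Fintype V] [DecidableEq V] {g : Finset V → ℝ}

open Classical in
/-- The nonempty penalized maximisers of `g` in `Z`. -/
noncomputable def penalizedChain (g : Finset V → ℝ) (Z : Finset V) : Finset (Finset V) :=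
  {D | D.Nonempty ∧ ∃ c, IsPenalizedMax g c Z D}

open Classical in
/-- The sets `T` which form the part outside `W`, of at least half the size, of a nonempty
penalized maximiser in `W ∪ T`. -/
noncomputable def fragments (g : Finset V → ℝ) (W : Finset V) : Finset (Finset V) :=
  {T | ∃ D ∈ penalizedChain g (W ∪ T), D \ W = T ∧ #D ≤ 2 * #T}

theorem mem_penalizedChain {Z D : Finset V} :
    D ∈ penalizedChain g Z ↔ D.Nonempty ∧ ∃ c, IsPenalizedMax g c Z D := by
  simp [penalizedChain]

theorem mem_fragments {W T : Finset V} :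
    T ∈ fragments g W ↔ ∃ D ∈ penalizedChain g (W ∪ T), D \ W = T ∧ #D ≤ 2 * #T := by
  simp [fragments]

theorem sum_penalizedChain_pow_le (hg : ∀ A B, g A + g B ≤ g (A ∪ B) + g (A ∩ B))
    (Z : Finset V) {z : ℝ} (hz : 0 ≤ z) (hz' : z ≤ 1 / 2) :
    ∑ D ∈ penalizedChain g Z, z ^ #D ≤ 2 * z := by
  have hinj : Set.InjOn (fun D : Finset V => #D) (penalizedChain g Z) := by
    intro D hD D' hD' h
    obtain ⟨-, c, hc⟩ := mem_penalizedChain.1 hD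
    obtain ⟨-, c', hc'⟩ := mem_penalizedChain.1 hD'
    exact hc.eq_of_card_eq hg hc' h
  have hsub : (penalizedChain g Z).image (fun D : Finset V => #D) ⊆
      (range (Fintype.card V)).image (· + 1) := by
    intro n hn
    obtain ⟨D, hD, rfl⟩ := mem_image.1 hn
    have h1 := (mem_penalizedChain.1 hD).1.card_pos
    have h2 := card_le_univ D
    exact mem_image.2 ⟨#D - 1, mem_range.2 (by omega), by omega⟩
  calc ∑ D ∈ penalizedChain g Z, z ^ #D
      = ∑ n ∈ (penalizedChain g Z).image (fun D : Finset V => #D), z ^ n :=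
        (sum_image hinj).symm
    _ ≤ ∑ n ∈ (range (Fintype.card V)).image (· + 1), z ^ n :=
        sum_le_sum_of_subset_of_nonneg hsub fun n _ _ => pow_nonneg hz n
    _ = (∑ n ∈ range (Fintype.card V), z ^ n) * z := by
        rw [sum_image fun a _ b _ h => Nat.succ_injective h, sum_mul]
        exact sum_congr rfl fun n _ => pow_succ z n
    _ ≤ 2 * z := by
        refine mul_le_mul_of_nonneg_right ?_ hz
        exact (sum_le_sum fun n _ => pow_le_pow_left₀ hz hz' n).trans (sum_geometric_two_le _)

open Classical in
theorem sum_subsets_penalizedChain_le (hg : ∀ A B, g A + g B ≤ g (A ∪ B) + g (A ∩ B))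
    (Z : Finset V) {y : ℝ} (hy : 0 ≤ y) (hy' : y ≤ 1 / 4) :
    ∑ T with ∃ D ∈ penalizedChain g Z, T ⊆ D ∧ #D ≤ 2 * #T, (y ^ 2) ^ #T ≤ 4 * y := by
  calc ∑ T with ∃ D ∈ penalizedChain g Z, T ⊆ D ∧ #D ≤ 2 * #T, (y ^ 2) ^ #T
      ≤ ∑ T, ∑ D ∈ penalizedChain g Z, if T ⊆ D then y ^ #D else 0 := by
        rw [sum_filter]
        refine sum_le_sum fun T _ => ?_
        have hnn : ∀ D ∈ penalizedChain g Z, 0 ≤ if T ⊆ D then y ^ #D else 0 := by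
          intro D _
          positivity
        split_ifs with h
        · obtain ⟨D, hD, hTD, hcard⟩ := h
          refine le_trans ?_ (single_le_sum hnn hD)
          rw [if_pos hTD, ← pow_mul]
          exact pow_le_pow_of_le_one hy (by linarith) hcard
        · exact sum_nonneg hnn
    _ = ∑ D ∈ penalizedChain g Z, (2 * y) ^ #D := by
        rw [sum_comm]
        refine sum_congr rfl fun D _ => ?_
        rw [← sum_filter, sum_const, filter_subset_univ, card_powerset, nsmul_eq_mul, mul_pow]
        push_cast
        rfl
    _ ≤ 2 * (2 * y) := sum_penalizedChain_pow_le hg Z (by linarith) (by linarith)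
    _ = 4 * y := by ring

/-- The expected cost of the fragments of a random set is small. -/
theorem sum_bernoulliWeight_fragments_le (hg : ∀ A B, g A + g B ≤ g (A ∪ B) + g (A ∩ B))
    {p q y : ℝ} (hq : 0 ≤ q) (hq' : q ≤ 1) (hy : 0 ≤ y) (hy' : y ≤ 1 / 4)
    (hp : p = y ^ 2 * q) :
    ∑ W, bernoulliWeight q W * ∑ T ∈ fragments g W, p ^ #T ≤ 4 * y := by
  classical
  set compat : Finset V → Finset (Finset V) := fun Z =>
    {T | ∃ D ∈ penalizedChain g Z, T ⊆ D ∧ #D ≤ 2 * #T} with hcompat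
  have hdisj : ∀ W, ∀ T ∈ fragments g W, Disjoint W T := by
    intro W T hT
    obtain ⟨D, -, rfl, -⟩ := mem_fragments.1 hT
    exact disjoint_sdiff
  set s : Finset (Σ _ : Finset V, Finset V) := univ.sigma (fragments g) with hs
  set φ : (Σ _ : Finset V, Finset V) → (Σ _ : Finset V, Finset V) :=
    fun a => ⟨a.1 ∪ a.2, a.2⟩ with hφ
  have hinj : Set.InjOn φ s := by
    rintro ⟨W, T⟩ h ⟨W', T'⟩ h' he
    have hT : T = T' := by simpa [hφ] using congrArg Sigma.snd he
    subst hT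
    have hU : W ∪ T = W' ∪ T := by simpa [hφ] using congrArg Sigma.fst he
    have d := hdisj W T (mem_sigma.1 h).2
    have d' := hdisj W' T (mem_sigma.1 h').2
    have : W = W' := by
      rw [← union_sdiff_cancel_right d, hU, union_sdiff_cancel_right d']
    rw [this]
  have hsub : s.image φ ⊆ univ.sigma compat := by
    intro b hb
    obtain ⟨⟨W, T⟩, h, rfl⟩ := mem_image.1 hb
    obtain ⟨D, hD, hT, hcard⟩ := mem_fragments.1 (mem_sigma.1 h).2
    refine mem_sigma.2 ⟨mem_univ _, mem_filter.2 ⟨mem_univ _, D, hD, ?_, hcard⟩⟩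
    exact hT.symm.subset.trans sdiff_subset
  calc ∑ W, bernoulliWeight q W * ∑ T ∈ fragments g W, p ^ #T
      = ∑ a ∈ s, bernoulliWeight q a.1 * p ^ #a.2 := by
        rw [hs, sum_sigma]
        exact sum_congr rfl fun W _ => mul_sum _ _ _
    _ ≤ ∑ a ∈ s, bernoulliWeight q (φ a).1 * (y ^ 2) ^ #(φ a).2 :=
        sum_le_sum fun a ha => bernoulliWeight_mul_pow_le hq hq' hp (sq_nonneg y)
          (hdisj _ _ (mem_sigma.1 ha).2)
    _ = ∑ b ∈ s.image φ, bernoulliWeight q b.1 * (y ^ 2) ^ #b.2 :=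
        (sum_image (f := fun b : (Σ _ : Finset V, Finset V) =>
          bernoulliWeight q b.1 * (y ^ 2) ^ #b.2) hinj).symm
    _ ≤ ∑ b ∈ univ.sigma compat, bernoulliWeight q b.1 * (y ^ 2) ^ #b.2 :=
        sum_le_sum_of_subset_of_nonneg hsub fun b _ _ =>
          mul_nonneg (bernoulliWeight_nonneg hq hq' _) (by positivity)
    _ = ∑ Z, bernoulliWeight q Z * ∑ T ∈ compat Z, (y ^ 2) ^ #T := by
        simp_rw [sum_sigma, mul_sum]
    _ ≤ ∑ Z : Finset V, bernoulliWeight q Z * (4 * y) :=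
        sum_le_sum fun Z _ => mul_le_mul_of_nonneg_left
          (sum_subsets_penalizedChain_le hg Z hy hy') (bernoulliWeight_nonneg hq hq' _)
    _ = 4 * y := by rw [← sum_mul, sum_bernoulliWeight, one_mul]

/-- If `g` loses little of its value on `W ∪ I` when `W` is removed, then `I` contains a fragment
of `W`. -/
theorem exists_fragment_subset (hg : ∀ A B, g A + g B ≤ g (A ∪ B) + g (A ∩ B))
    (hmono : Monotone g) {W I : Finset V}
    (h : 4 * (g (W ∪ I) - g ((W ∪ I) \ W)) < g (W ∪ I) - g ∅) :
    ∃ T ∈ fragments g W, T ⊆ I := by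
  obtain ⟨c, D, hD, hne, hcard⟩ := exists_isPenalizedMax_inter_le hg hmono h
  have hDW : D ⊆ W ∪ (D \ W) := by rw [union_sdiff_self_eq_union]; exact subset_union_right
  have hDI : D \ W ⊆ I := by
    exact sdiff_le_iff.2 hD.1
  have hsub : W ∪ (D \ W) ⊆ W ∪ I := union_subset_union_right hDI
  refine ⟨D \ W, mem_fragments.2 ⟨D, mem_penalizedChain.2 ⟨hne, c, ?_⟩, rfl, ?_⟩, hDI⟩
  · exact hD.mono hsub hDW
  · have := card_sdiff_add_card_inter D W
    rw [inter_comm] at this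
    omega

end Fragments

section SubsetSum

theorem monotone_sum_powerset {V : Type*} {lam : Finset V → ℝ} (h0 : ∀ S, 0 ≤ lam S) :
    Monotone fun D : Finset V => ∑ S ∈ D.powerset, lam S := fun _ _ h =>
  sum_le_sum_of_subset_of_nonneg (powerset_mono.2 h) fun S _ _ => h0 S

variable {V : Type*} [DecidableEq V] {lam : Finset V → ℝ}

theorem sum_powerset_supermodular (h0 : ∀ S, 0 ≤ lam S) (A B : Finset V) :
    ∑ S ∈ A.powerset, lam S + ∑ S ∈ B.powerset, lam S ≤
      ∑ S ∈ (A ∪ B).powerset, lam S + ∑ S ∈ (A ∩ B).powerset, lam S := by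
  have hinter : A.powerset ∩ B.powerset = (A ∩ B).powerset := by
    ext S
    simp only [mem_inter, mem_powerset, subset_inter_iff]
  rw [← sum_union_inter, hinter]
  refine add_le_add_left (sum_le_sum_of_subset_of_nonneg ?_ fun S _ _ => h0 S) _
  exact union_subset (powerset_mono.2 subset_union_left) (powerset_mono.2 subset_union_right)

variable [Fintype V]

/-- The total weight of the sets which properly contain `B` and whose other elements all lie
in `W`. -/
noncomputable def linkWeight (lam : Finset V → ℝ) (W B : Finset V) : ℝ :=
  ∑ S with B ⊂ S ∧ S \ B ⊆ W, lam S

theorem linkWeight_nonneg (h0 : ∀ S, 0 ≤ lam S) (W B : Finset V) : 0 ≤ linkWeight lam W B :=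
  sum_nonneg fun S _ => h0 S

theorem linkWeight_eq_zero {r : ℕ} (hr : ∀ S : Finset V, r + 1 < #S → lam S = 0)
    (W : Finset V) {B : Finset V} (hB : r < #B) : linkWeight lam W B = 0 := by
  refine sum_eq_zero fun S hS => hr S ?_
  have := card_lt_card (mem_filter.1 hS).2.1
  omega

theorem sum_powerset_union_sub_le (h0 : ∀ S, 0 ≤ lam S) (W I : Finset V) :
    ∑ S ∈ (W ∪ I).powerset, lam S - ∑ S ∈ ((W ∪ I) \ W).powerset, lam S ≤
      ∑ B ∈ I.powerset, linkWeight lam W B := by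
  rw [← sum_sdiff (powerset_mono.2 (sdiff_subset (s := W ∪ I) (t := W))), add_sub_cancel_right]
  have hmaps : ∀ S ∈ (W ∪ I).powerset \ ((W ∪ I) \ W).powerset, S \ W ∈ I.powerset := by
    intro S hS
    exact mem_powerset.2 (sdiff_le_iff.2 (mem_powerset.1 (mem_sdiff.1 hS).1))
  rw [← sum_fiberwise_of_maps_to hmaps]
  refine sum_le_sum fun B _ => sum_le_sum_of_subset_of_nonneg ?_ fun S _ _ => h0 S
  intro S hS
  obtain ⟨hS', rfl⟩ := mem_filter.1 hS
  obtain ⟨h1, h2⟩ := mem_sdiff.1 hS'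
  rw [mem_powerset] at h1 h2
  refine mem_filter.2 ⟨mem_univ _, Finset.ssubset_iff_subset_ne.2 ⟨sdiff_subset, fun he => h2 ?_⟩, ?_⟩
  · rw [← he]
    exact sdiff_subset_sdiff h1 subset_rfl
  · rw [sdiff_sdiff_right_self]
    exact inter_subset_right

/-- The expected weight of the link of a random set is controlled by the weight of `lam`. -/
theorem sum_bernoulliWeight_linkWeight_le (h0 : ∀ S, 0 ≤ lam S) {r : ℕ}
    (hr : ∀ S : Finset V, r < #S → lam S = 0) {q s : ℝ} (hs : 0 ≤ s) (hsq : s ≤ q) :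
    ∑ W, bernoulliWeight q W * ∑ B, linkWeight lam W B * s ^ #B ≤
      2 ^ r * ∑ S, lam S * q ^ #S := by
  have hq : 0 ≤ q := hs.trans hsq
  calc ∑ W, bernoulliWeight q W * ∑ B, linkWeight lam W B * s ^ #B
      = ∑ W : Finset V, ∑ B : Finset V, ∑ S : Finset V, (if B ⊂ S then lam S * s ^ #B else 0) *
          (if S \ B ⊆ W then bernoulliWeight q W else 0) := by
        refine sum_congr rfl fun W _ => ?_
        rw [mul_sum]
        refine sum_congr rfl fun B _ => ?_
        rw [linkWeight, sum_filter, sum_mul, mul_sum]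
        refine sum_congr rfl fun S _ => ?_
        by_cases h1 : B ⊂ S <;> by_cases h2 : S \ B ⊆ W <;> simp [h1, h2, mul_comm]
    _ = ∑ S : Finset V, ∑ B : Finset V, ∑ W : Finset V, (if B ⊂ S then lam S * s ^ #B else 0) *
          (if S \ B ⊆ W then bernoulliWeight q W else 0) := by
        rw [sum_comm, sum_congr rfl fun B _ => sum_comm, sum_comm]
    _ = ∑ S : Finset V, ∑ B : Finset V, (if B ⊂ S then lam S * s ^ #B else 0) * q ^ #(S \ B) := by
        simp_rw [← mul_sum, sum_bernoulliWeight_superset]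
    _ ≤ ∑ S, ∑ B ∈ S.powerset, lam S * q ^ #S := by
        refine sum_le_sum fun S _ => ?_
        rw [← filter_subset_univ, sum_filter]
        refine sum_le_sum fun B _ => ?_
        by_cases h : B ⊂ S
        · rw [if_pos h, if_pos h.subset, mul_assoc]
          refine mul_le_mul_of_nonneg_left ?_ (h0 S)
          rw [← card_sdiff_add_card_eq_card h.subset, add_comm, pow_add]
          gcongr
        · rw [if_neg h, zero_mul]
          have := h0 S
          positivity
    _ ≤ ∑ S, 2 ^ r * (lam S * q ^ #S) := by
        refine sum_le_sum fun S _ => ?_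
        rw [sum_const, card_powerset, nsmul_eq_mul]
        rcases lt_or_ge r #S with h | h
        · simp [hr S h]
        · refine mul_le_mul_of_nonneg_right ?_ (mul_nonneg (h0 S) (pow_nonneg hq _))
          push_cast
          exact pow_le_pow_right₀ one_le_two h
    _ = 2 ^ r * ∑ S, lam S * q ^ #S := (mul_sum _ _ _).symm

end SubsetSum

/-- Some set satisfies two Markov-type bounds at once: both nonnegative functions are at most twice
the given bounds on their means. -/
theorem exists_le_of_sum_bernoulliWeight_le {V : Type*} [Fintype V] [DecidableEq V] {q : ℝ}
    (h0 : 0 ≤ q) (h1 : q ≤ 1) {X Y : Finset V → ℝ} {x y : ℝ} (hx : 0 < x) (hy : 0 < y)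
    (hX : ∀ W, 0 ≤ X W) (hY : ∀ W, 0 ≤ Y W)
    (hEX : ∑ W, bernoulliWeight q W * X W ≤ x / 2)
    (hEY : ∑ W, bernoulliWeight q W * Y W ≤ y / 2) :
    ∃ W, X W ≤ x ∧ Y W ≤ y := by
  by_contra! hcon
  have hlarge : ∀ W, x * y < y * X W + x * Y W := by
    intro W
    rcases le_or_gt (X W) x with h | h
    · nlinarith [hcon W h, mul_nonneg hy.le (hX W)]
    · nlinarith [mul_nonneg hx.le (hY W)]
  obtain ⟨W₀, -, hW₀⟩ : ∃ W ∈ (univ : Finset (Finset V)), 0 < bernoulliWeight q W := by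
    by_contra! hle
    have := sum_nonpos hle
    rw [sum_bernoulliWeight] at this
    linarith
  have hlt : ∑ W : Finset V, bernoulliWeight q W * (x * y) <
      ∑ W, bernoulliWeight q W * (y * X W + x * Y W) :=
    sum_lt_sum (fun W _ => mul_le_mul_of_nonneg_left (hlarge W).le (bernoulliWeight_nonneg h0 h1 W))
      ⟨W₀, mem_univ _, mul_lt_mul_of_pos_left (hlarge W₀) hW₀⟩
  have hsum : ∑ W, bernoulliWeight q W * (y * X W + x * Y W) =
      y * ∑ W, bernoulliWeight q W * X W + x * ∑ W, bernoulliWeight q W * Y W := by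
    rw [mul_sum, mul_sum, ← sum_add_distrib]
    exact sum_congr rfl fun W _ => by ring
  rw [← sum_mul, sum_bernoulliWeight, one_mul, hsum] at hlt
  nlinarith

/-- Fractional covers by sets of bounded size can be rounded, at the cost of a constant factor in
`p`, to covers of arbitrarily small cost. -/
theorem exists_cover_of_fractional_cover (r : ℕ) : ∀ κ : ℝ, 0 < κ → ∃ J ε : ℝ, 1 ≤ J ∧ 0 < ε ∧
    ∀ (V : Type) [Fintype V] [DecidableEq V] (lam : Finset V → ℝ) (p : ℝ), 0 < p →
      (∀ S, 0 ≤ lam S) → (∀ S : Finset V, r < #S → lam S = 0) →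
      ∑ S, lam S * (J * p) ^ #S ≤ ε →
      ∃ G : Finset (Finset V), ∑ T ∈ G, p ^ #T ≤ κ ∧
        ∀ I : Finset V, 1 ≤ ∑ S ∈ I.powerset, lam S → ∃ T ∈ G, T ⊆ I := by
  induction r with
  | zero =>
    intro κ hκ
    refine ⟨1, 1 / 2, le_rfl, by norm_num, fun V _ _ lam p hp h0 hr hsum => ⟨∅, by simpa using hκ.le,
      fun I hI => ?_⟩⟩
    have h1 : ∑ S ∈ I.powerset, lam S ≤ ∑ S, lam S * (1 * p) ^ #S := by
      refine (sum_le_sum_of_subset_of_nonneg (subset_univ _) fun S _ _ => h0 S).trans ?_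
      refine sum_le_sum fun S _ => ?_
      rcases Nat.eq_zero_or_pos #S with h | h
      · simp [h]
      · simp [hr S h]
    linarith
  | succ r ih =>
    intro κ hκ
    obtain ⟨J₀, ε₀, hJ₀, hε₀, hcover⟩ := ih (κ / 2) (by positivity)
    obtain ⟨Y, hYJ, hY4, hYκ⟩ : ∃ Y : ℝ, J₀ ≤ Y ∧ 4 ≤ Y ∧ 16 / κ ≤ Y :=
      ⟨max J₀ (max 4 (16 / κ)), le_max_left _ _, (le_max_left _ _).trans (le_max_right _ _),
        (le_max_right _ _).trans (le_max_right _ _)⟩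
    have hYpos : 0 < Y := by linarith
    refine ⟨Y ^ 2, min (1 / 4) (ε₀ / (32 * 2 ^ (r + 1))), by nlinarith, by positivity,
      fun V _ _ lam p hp h0 hr hsum => ?_⟩
    obtain ⟨hsum1, hsum2⟩ := le_min_iff.1 hsum
    set q := Y ^ 2 * p with hq
    have hq0 : 0 < q := by positivity
    rcases le_or_gt 1 q with hq1 | hq1
    · refine ⟨∅, by simpa using hκ.le, fun I hI => ?_⟩
      have h1 : ∑ S ∈ I.powerset, lam S ≤ ∑ S, lam S * q ^ #S := by
        refine (sum_le_sum_of_subset_of_nonneg (subset_univ _) fun S _ _ => h0 S).trans ?_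
        exact sum_le_sum fun S _ => le_mul_of_one_le_right (h0 S) (one_le_pow₀ hq1)
      linarith
    set g : Finset V → ℝ := fun D => ∑ S ∈ D.powerset, lam S with hg_def
    have hg : ∀ A B, g A + g B ≤ g (A ∪ B) + g (A ∩ B) := sum_powerset_supermodular h0
    have hg_mono : Monotone g := monotone_sum_powerset h0
    have hsq : J₀ * p ≤ q := by
      refine mul_le_mul_of_nonneg_right ?_ hp.le
      nlinarith
    have hs0 : 0 ≤ J₀ * p := by positivity
    have hEX : ∑ W, bernoulliWeight q W * ∑ B, linkWeight lam W B * (J₀ * p) ^ #B ≤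
        ε₀ / 16 / 2 := by
      refine (sum_bernoulliWeight_linkWeight_le h0 hr hs0 hsq).trans ?_
      rw [le_div_iff₀ (by positivity)] at hsum2
      linarith
    have hEY : ∑ W, bernoulliWeight q W * ∑ T ∈ fragments g W, p ^ #T ≤ κ / 2 / 2 := by
      refine (sum_bernoulliWeight_fragments_le hg hq0.le hq1.le (y := 1 / Y) (by positivity)
        (one_div_le_one_div_of_le (by norm_num) hY4) (by rw [hq]; field_simp)).trans ?_
      rw [div_le_iff₀ hκ] at hYκ
      rw [mul_one_div, div_le_iff₀ hYpos]
      linarith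
    obtain ⟨W, hWX, hWY⟩ := exists_le_of_sum_bernoulliWeight_le hq0.le hq1.le
      (by positivity : 0 < ε₀ / 16) (by positivity : 0 < κ / 2)
      (fun W => sum_nonneg fun B _ => mul_nonneg (linkWeight_nonneg h0 W B) (pow_nonneg hs0 _))
      (fun W => sum_nonneg fun T _ => pow_nonneg hp.le _) hEX hEY
    obtain ⟨G, hG, hGcover⟩ := hcover V (fun B => 16 * linkWeight lam W B) p hp
      (fun B => mul_nonneg (by norm_num) (linkWeight_nonneg h0 W B))
      (fun B hB => by simp [linkWeight_eq_zero hr W hB])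
      (by simp_rw [mul_assoc, ← mul_sum]; linarith)
    refine ⟨G ∪ fragments g W, ?_, fun I hI => ?_⟩
    · have := sum_union_inter (s₁ := G) (s₂ := fragments g W) (f := fun T => p ^ #T)
      have h' : 0 ≤ ∑ T ∈ G ∩ fragments g W, p ^ #T := sum_nonneg fun T _ => pow_nonneg hp.le _
      linarith
    rcases le_or_gt 1 (∑ B ∈ I.powerset, 16 * linkWeight lam W B) with h | h
    · obtain ⟨T, hT, hTI⟩ := hGcover I h
      exact ⟨T, mem_union_left _ hT, hTI⟩
    · rw [← mul_sum] at h
      have hloss : g (W ∪ I) - g ((W ∪ I) \ W) ≤ _ := sum_powerset_union_sub_le h0 W I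
      have hI' : 1 ≤ g (W ∪ I) := hI.trans (hg_mono subset_union_right)
      have hempty : g ∅ ≤ 1 / 4 := by
        have := single_le_sum (f := fun S : Finset V => lam S * q ^ #S)
          (fun S _ => mul_nonneg (h0 S) (pow_nonneg hq0.le _)) (mem_univ ∅)
        simp only [card_empty, pow_zero, mul_one] at this
        simp only [hg_def, powerset_empty, sum_singleton]
        linarith
      obtain ⟨T, hT, hTI⟩ := exists_fragment_subset hg hg_mono (W := W) (I := I) (by linarith)
      exact ⟨T, mem_union_right _ hT, hTI⟩

/-- For every positive integer `r` there is `J > 0` such that for every finite `V`,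
every increasing `F ⊆ 2^V` and every `p ∈ (0,1]`: if `F` is weakly `(Jp, r)`-small
then `F` is `p`-small. -/
theorem weakly_pr_small_implies_p_small (r : ℕ) (hr : 0 < r) :
    ∃ J : ℝ, 0 < J ∧
      ∀ (V : Type) [Fintype V] [DecidableEq V] (F : Finset (Finset V)),
        Increasing F →
        ∀ p : ℝ, 0 < p → p ≤ 1 →
          WeaklyPRSmall F (J * p) r → PSmall F p := by
  obtain ⟨J, ε, hJ, hε, hcover⟩ := exists_cover_of_fractional_cover r (1 / 2) (by norm_num)
  have hJ0 : 0 < J := by linarith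
  refine ⟨J * max 1 (1 / ε), by positivity, fun V _ _ F _ p hp _ hF => ?_⟩
  obtain ⟨lam, h0, hsupp, hF, hsum⟩ := hF
  set M := max 1 (1 / ε) with hM
  have hM1 : 1 ≤ M := le_max_left _ _
  have hMε : 1 ≤ M * ε := by
    rw [← div_le_iff₀ hε]
    exact le_max_right _ _
  rw [powerset_univ] at hsum
  have hempty : lam ∅ ≤ 1 / 2 := by
    have := single_le_sum (f := fun S : Finset V => lam S * (J * M * p) ^ #S)
      (fun S _ => mul_nonneg (h0 S) (by positivity)) (mem_univ ∅)
    simp only [card_empty, pow_zero, mul_one] at this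
    linarith
  obtain ⟨G, hG, hGcover⟩ := hcover V (fun S => if S = ∅ then 0 else 2 * lam S) p hp
    (fun S => by have := h0 S; positivity) (fun S hS => by simp [hsupp S hS]) (by
      have hle : ∀ S : Finset V, (if S = ∅ then 0 else 2 * lam S) * (J * p) ^ #S ≤
          2 * ε * (lam S * (J * M * p) ^ #S) := by
        intro S
        split_ifs with hS
        · have := h0 S
          rw [zero_mul]
          positivity
        · have hpow : M ≤ M ^ #S :=
            le_self_pow₀ hM1 (card_ne_zero.2 (nonempty_iff_ne_empty.2 hS))
          have h1 : 1 ≤ ε * M ^ #S := by nlinarith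
          have h2 : 0 ≤ lam S * (J * p) ^ #S := mul_nonneg (h0 S) (by positivity)
          calc 2 * lam S * (J * p) ^ #S = 2 * (lam S * (J * p) ^ #S) * 1 := by ring
            _ ≤ 2 * (lam S * (J * p) ^ #S) * (ε * M ^ #S) := by gcongr
            _ = 2 * ε * (lam S * (J * M * p) ^ #S) := by
              rw [mul_right_comm J M p, mul_pow (J * p) M]
              ring
      refine (sum_le_sum fun S _ => hle S).trans ?_
      rw [← mul_sum]
      nlinarith)
  refine ⟨G, fun I hI => hGcover I ?_, hG⟩
  have h1 := hF I hI
  rw [← add_sum_erase _ _ (empty_mem_powerset I)] at h1 ⊢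
  have h2 : ∑ S ∈ I.powerset.erase ∅, (if S = ∅ then 0 else 2 * lam S) =
      2 * ∑ S ∈ I.powerset.erase ∅, lam S := by
    rw [mul_sum]
    exact sum_congr rfl fun S hS => if_neg (ne_of_mem_erase hS)
  rw [h2, if_pos rfl]
  linarith
end

section
/- For every positive integer r there is a constant C > 0 with the following property. Let V be a finite set with |V| = n, let F ⊆ 2^V be an increasing family, and for each I ∈ F let μ_I : I → [0,∞) be weights with Σ_{v ∈ I} μ_I(v) = 1. Suppose p ∈ (0,1] and F is not p-small. Let W be chosen uniformly at random from the m-element subsets of V (where 1 ≤ m ≤ n). Then the probability that W is (1 − 1/(2r))-bad with respect to the weights (μ_I)_{I ∈ F} is strictly less than 2 Σ_{t=1}^{n} (C n p / m)^t. -/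
open Finset
open scoped Classical

/-- If every superlevel set of `f` on `J` has nonpositive `g`-weight, then `∑ g f ≤ 0`. -/
lemma sum_mul_nonpos_of_superlevel {V : Type*} (f g : V → ℝ) (hf : ∀ v, 0 ≤ f v) (J : Finset V)
    (h : ∀ x ∈ J, ∑ v ∈ J with f x ≤ f v, g v ≤ 0) :
    ∑ v ∈ J, g v * f v ≤ 0 := by
  induction J using Finset.strongInduction generalizing f with
  | _ J ih =>
    rcases J.eq_empty_or_nonempty with rfl | hJ
    · simp
    obtain ⟨x, hx, hmin⟩ := J.exists_min_image f hJ
    have hall : ∑ v ∈ J, g v ≤ 0 := by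
      have := h x hx
      rwa [Finset.filter_true_of_mem hmin] at this
    set J' := J.filter (fun v => f x < f v) with hJ'
    have hss : J' ⊂ J := Finset.filter_ssubset.2 ⟨x, hx, by simp⟩
    have key := ih J' hss (fun v => max (f v - f x) 0) (fun v => le_max_right _ _) (by
      intro y hy
      obtain ⟨hyJ, hy⟩ := Finset.mem_filter.1 hy
      have hset : (J'.filter fun v => max (f y - f x) 0 ≤ max (f v - f x) 0) =
          J.filter fun v => f y ≤ f v := by
        ext v
        simp only [hJ', Finset.mem_filter]
        constructor
        · rintro ⟨⟨hv, hxv⟩, hle⟩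
          rw [max_eq_left (by linarith), max_eq_left (by linarith)] at hle
          exact ⟨hv, by linarith⟩
        · rintro ⟨hv, hle⟩
          exact ⟨⟨hv, by linarith⟩, max_le_max_right _ (by linarith)⟩
      rw [hset]
      exact h y hyJ)
    have hsplit : ∑ v ∈ J, g v * f v =
        (∑ v ∈ J, g v) * f x + ∑ v ∈ J', g v * max (f v - f x) 0 := by
      rw [Finset.sum_mul, hJ', Finset.sum_filter, ← Finset.sum_add_distrib]
      refine Finset.sum_congr rfl fun v hv => ?_
      have := hmin v hv
      split_ifs with hlt
      · rw [max_eq_left (by linarith)]; ring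
      · rw [le_antisymm (not_lt.1 hlt) this]; ring
    rw [hsplit]
    have := mul_nonpos_of_nonpos_of_nonneg hall (hf x)
    linarith

section Fragments

variable {V : Type*} [DecidableEq V]

/-- If `W` carries less than a `1 - 1/q` proportion of the weight `f` on `J`, then some
superlevel set of `f` has more than a `1/q` proportion of its elements outside `W`. -/
lemma exists_superlevel_card_lt (f : V → ℝ) (hf : ∀ v, 0 ≤ f v) (J W : Finset V)
    (hsum : ∑ v ∈ J, f v = 1) (q : ℕ) (hq : 0 < q)
    (hW : ∑ v ∈ W ∩ J, f v < 1 - 1 / (q : ℝ)) :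
    ∃ x ∈ J, #{v ∈ J | f x ≤ f v} < q * #({v ∈ J | f x ≤ f v} \ W) := by
  by_contra! hcon
  have h := sum_mul_nonpos_of_superlevel f (fun v => (q : ℝ) * (if v ∈ W then 0 else 1) - 1) hf J
    (by
      intro x hx
      have hc := hcon x hx
      have hcard : ∑ v ∈ J with f x ≤ f v, (if v ∈ W then (0 : ℝ) else 1) =
          #({v ∈ J | f x ≤ f v} \ W) := by
        rw [← Finset.filter_notMem_eq_sdiff, Finset.card_filter]
        push_cast
        exact Finset.sum_congr rfl fun v _ => by split_ifs <;> simp_all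
      rw [Finset.sum_sub_distrib, ← Finset.mul_sum, hcard]
      simp only [Finset.sum_const, nsmul_eq_mul, mul_one]
      have : (q : ℝ) * #({v ∈ J | f x ≤ f v} \ W) ≤ #{v ∈ J | f x ≤ f v} := by
        exact_mod_cast hc
      linarith)
  have hq' : (0 : ℝ) < q := by exact_mod_cast hq
  have hrest : ∑ v ∈ J, ((q : ℝ) * (if v ∈ W then 0 else 1) - 1) * f v =
      q * (∑ v ∈ J, f v - ∑ v ∈ W ∩ J, f v) - ∑ v ∈ J, f v := by
    rw [Finset.inter_comm, ← Finset.filter_mem_eq_inter, Finset.sum_filter,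
      ← Finset.sum_sub_distrib, Finset.mul_sum, ← Finset.sum_sub_distrib]
    refine Finset.sum_congr rfl fun v _ => ?_
    split_ifs <;> ring
  rw [hrest, hsum] at h
  have : (q : ℝ) * (1 / q) = 1 := by field_simp
  nlinarith

/-- `A` is a largest member of `𝒞` with more than a `1/q` proportion of its elements
outside `W`. -/
def IsLargestSparse (q : ℕ) (𝒞 : Finset (Finset V)) (W A : Finset V) : Prop :=
  (A ∈ 𝒞 ∧ #A < q * #(A \ W)) ∧ ∀ B ∈ 𝒞, #B < q * #(B \ W) → #B ≤ #A

lemma exists_isLargestSparse {q : ℕ} {𝒞 : Finset (Finset V)} {W : Finset V}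
    (h : ∃ A ∈ 𝒞, #A < q * #(A \ W)) : ∃ A, IsLargestSparse q 𝒞 W A := by
  obtain ⟨A, hA, hmax⟩ := (𝒞.filter fun A => #A < q * #(A \ W)).exists_max_image Finset.card
    (by obtain ⟨A, hA⟩ := h; exact ⟨A, Finset.mem_filter.2 hA⟩)
  exact ⟨A, Finset.mem_filter.1 hA, fun B hB hB' => hmax B (Finset.mem_filter.2 ⟨hB, hB'⟩)⟩

/-- If the largest sparse sets of a chain with respect to `W₁` and `W₂` are `A₁` and `A₂`, and
`A₂ \ W₂` and `T₁` have the same size and the same disjoint union with `W₂` and `W₁`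
respectively, then `A₁ ⊆ A₂`. -/
lemma IsLargestSparse.subset {q : ℕ} {𝒞 : Finset (Finset V)} {W₁ W₂ T₁ A₁ A₂ : Finset V}
    (hchain : ∀ A ∈ 𝒞, ∀ B ∈ 𝒞, A ⊆ B ∨ B ⊆ A)
    (h₁ : IsLargestSparse q 𝒞 W₁ A₁) (h₂ : IsLargestSparse q 𝒞 W₂ A₂)
    (hZ : W₁ ∪ T₁ = W₂ ∪ A₂ \ W₂) (hcard : #T₁ = #(A₂ \ W₂)) : A₁ ⊆ A₂ := by
  rcases hchain A₁ h₁.1.1 A₂ h₂.1.1 with h | h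
  · exact h
  suffices hle : #A₁ ≤ #A₂ from (Finset.eq_of_subset_of_card_le h hle).ge
  refine h₂.2 A₁ h₁.1.1 (h₁.1.2.trans_le (Nat.mul_le_mul_left q ?_))
  set Z := W₁ ∪ T₁ with hZdef
  have h1 : A₁ \ W₁ ⊆ A₁ \ Z ∪ T₁ := by
    intro v hv
    simp only [hZdef, Finset.mem_sdiff, Finset.mem_union] at hv ⊢
    tauto
  have h2 : A₁ \ Z ∪ A₂ \ W₂ ⊆ A₁ \ W₂ := by
    rw [hZ]
    intro v hv
    have := @h v
    simp only [Finset.mem_sdiff, Finset.mem_union] at hv ⊢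
    tauto
  have hdisj : Disjoint (A₁ \ Z) (A₂ \ W₂) := by
    rw [hZ]
    exact Finset.disjoint_left.2 fun v hv hv' =>
      (Finset.mem_sdiff.1 hv).2 (Finset.mem_union_right _ hv')
  calc #(A₁ \ W₁) ≤ #(A₁ \ Z ∪ T₁) := Finset.card_le_card h1
    _ ≤ #(A₁ \ Z) + #T₁ := Finset.card_union_le _ _
    _ = #(A₁ \ Z ∪ A₂ \ W₂) := by rw [hcard, Finset.card_union_of_disjoint hdisj]
    _ ≤ #(A₁ \ W₂) := Finset.card_le_card h2

/-- The inclusion-minimal sets of the form `A J \ W` with `J ∈ F`. -/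
def minimalFragments (F : Finset (Finset V)) (A : Finset V → Finset V) (W : Finset V) :
    Finset (Finset V) :=
  (F.image fun J => A J \ W).filter fun T => ∀ J ∈ F, A J \ W ⊆ T → A J \ W = T

lemma mem_minimalFragments {F : Finset (Finset V)} {A : Finset V → Finset V} {W T : Finset V} :
    T ∈ minimalFragments F A W ↔
      (∃ J ∈ F, A J \ W = T) ∧ ∀ J ∈ F, A J \ W ⊆ T → A J \ W = T := by
  simp [minimalFragments]

lemma exists_minimalFragment_subset {F : Finset (Finset V)} {A : Finset V → Finset V}
    {W I : Finset V} (hI : I ∈ F) (hA : A I ⊆ I) : ∃ T ∈ minimalFragments F A W, T ⊆ I := by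
  obtain ⟨T, hTI, hT⟩ := (F.image fun J => A J \ W).exists_le_minimal
    (Finset.mem_image_of_mem _ hI)
  refine ⟨T, mem_minimalFragments.2 ⟨by simpa using hT.1, fun J hJ hle => ?_⟩,
    hTI.trans (Finset.sdiff_subset.trans hA)⟩
  exact hle.antisymm (hT.2 (Finset.mem_image_of_mem _ hJ) hle)

/-- Double counting of the pairs `(W, T)` with `T` a minimal fragment of size `t` for `W`,
through the unions `W ∪ T`. -/
lemma sum_card_minimalFragments_le [Fintype V] {F : Finset (Finset V)}
    {𝒞 : Finset V → Finset (Finset V)} {q m : ℕ} {𝓑 : Finset (Finset V)}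
    {A : Finset V → Finset V → Finset V}
    (hchain : ∀ J ∈ F, ∀ A ∈ 𝒞 J, ∀ B ∈ 𝒞 J, A ⊆ B ∨ B ⊆ A)
    (h𝓑 : ∀ W ∈ 𝓑, #W = m)
    (hA : ∀ W ∈ 𝓑, ∀ J ∈ F, IsLargestSparse q (𝒞 J) W (A W J)) (t : ℕ) :
    ∑ W ∈ 𝓑, #{T ∈ minimalFragments F (A W) W | #T = t} ≤
      2 ^ (q * t) * (Fintype.card V).choose (m + t) := by
  have hdisj : ∀ W T, T ∈ minimalFragments F (A W) W → Disjoint W T := by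
    intro W T hT
    obtain ⟨⟨J, -, rfl⟩, -⟩ := mem_minimalFragments.1 hT
    exact Finset.disjoint_sdiff
  rw [← Finset.card_sigma, ← Finset.card_univ, ← Finset.card_powersetCard]
  refine Finset.card_le_mul_card_image_of_maps_to (f := fun x => x.1 ∪ x.2) ?_ _ ?_
  · rintro ⟨W, T⟩ hx
    simp only [Finset.mem_sigma, Finset.mem_filter] at hx
    simp only [Finset.mem_powersetCard, Finset.subset_univ, true_and]
    rw [Finset.card_union_of_disjoint (hdisj W T hx.2.1), h𝓑 W hx.1, hx.2.2]
  · intro Z _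
    rcases Finset.eq_empty_or_nonempty
      {x ∈ 𝓑.sigma fun W => {T ∈ minimalFragments F (A W) W | #T = t} | x.1 ∪ x.2 = Z}
      with he | ⟨⟨W₂, T₂⟩, hx₂⟩
    · rw [he]; simp
    simp only [Finset.mem_filter, Finset.mem_sigma] at hx₂
    obtain ⟨⟨hW₂, hT₂, rfl⟩, hZ₂⟩ := hx₂
    obtain ⟨⟨J, hJ, rfl⟩, -⟩ := mem_minimalFragments.1 hT₂
    have h₂ := hA W₂ hW₂ J hJ
    have hpow : #(A W₂ J).powerset ≤ 2 ^ (q * #(A W₂ J \ W₂)) := by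
      rw [Finset.card_powerset]
      exact Nat.pow_le_pow_right two_pos h₂.1.2.le
    refine le_trans (Finset.card_le_card_of_injOn (fun x => x.2) ?_ ?_) hpow
    · rintro ⟨W₁, T₁⟩ hx
      simp only [Finset.coe_filter, Set.mem_ofPred_eq, Finset.mem_filter, Finset.mem_sigma] at hx
      obtain ⟨⟨hW₁, hT₁, hcard⟩, hZ₁⟩ := hx
      have h₁ := hA W₁ hW₁ J hJ
      have hsub := h₁.subset (hchain J hJ) h₂ (hZ₁.trans hZ₂.symm) hcard
      have hfrag : A W₁ J \ W₁ ⊆ T₁ := by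
        intro v hv
        obtain ⟨hv, hvW⟩ := Finset.mem_sdiff.1 hv
        have : v ∈ W₁ ∪ T₁ := by
          rw [hZ₁, ← hZ₂, Finset.union_sdiff_self_eq_union]
          exact Finset.mem_union_right _ (hsub hv)
        exact (Finset.mem_union.1 this).resolve_left hvW
      have heq := (mem_minimalFragments.1 hT₁).2 J hJ hfrag
      simp only [Finset.coe_powerset, Set.mem_preimage, Set.mem_powerset_iff, Finset.coe_subset]
      rw [← heq]
      exact Finset.sdiff_subset.trans hsub
    · rintro ⟨W₁, T₁⟩ hx ⟨W₃, T₃⟩ hy (rfl : T₁ = T₃)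
      simp only [Finset.coe_filter, Set.mem_ofPred_eq, Finset.mem_filter, Finset.mem_sigma] at hx hy
      have e : W₁ = W₃ := by
        rw [← Finset.union_sdiff_cancel_right (hdisj W₁ T₁ hx.1.2.1),
          ← Finset.union_sdiff_cancel_right (hdisj W₃ T₁ hy.1.2.1), hx.2, hy.2]
      rw [e]

end Fragments

lemma choose_add_le_mul_div_pow (n m t : ℕ) (hm : 0 < m) :
    (n.choose (m + t) : ℝ) ≤ n.choose m * ((n : ℝ) / m) ^ t := by
  have hm' : (0 : ℝ) < m := by exact_mod_cast hm
  induction t with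
  | zero => simp
  | succ t ih =>
    have hstep : (n.choose (m + (t + 1)) : ℝ) * m ≤ n.choose (m + t) * n := by
      have h := Nat.choose_succ_right_eq n (m + t)
      have : n.choose (m + (t + 1)) * m ≤ n.choose (m + t) * n :=
        calc n.choose (m + (t + 1)) * m ≤ n.choose (m + t + 1) * (m + t + 1) :=
              Nat.mul_le_mul_left _ (by omega)
          _ = n.choose (m + t) * (n - (m + t)) := h
          _ ≤ _ := Nat.mul_le_mul_left _ (Nat.sub_le _ _)
      exact_mod_cast this
    calc (n.choose (m + (t + 1)) : ℝ) ≤ n.choose (m + t) * ((n : ℝ) / m) := by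
          rw [← mul_div_assoc, le_div_iff₀ hm']; exact hstep
      _ ≤ n.choose m * ((n : ℝ) / m) ^ t * ((n : ℝ) / m) := by gcongr
      _ = _ := by ring

/-- If every member of `𝓑` admits a largest sparse set in the chain of every `J ∈ F`, and `F`
is not `p`-small, then `𝓑` is small. -/
lemma card_lt_of_isLargestSparse {V : Type*} [Fintype V] [DecidableEq V]
    {F : Finset (Finset V)} {𝒞 : Finset V → Finset (Finset V)} {q m : ℕ} (hm : 0 < m)
    {𝓑 : Finset (Finset V)} (hne : 𝓑.Nonempty) {A : Finset V → Finset V → Finset V}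
    (hchain : ∀ J ∈ F, ∀ A ∈ 𝒞 J, ∀ B ∈ 𝒞 J, A ⊆ B ∨ B ⊆ A)
    (hsub : ∀ J ∈ F, ∀ A ∈ 𝒞 J, A ⊆ J)
    (h𝓑 : ∀ W ∈ 𝓑, #W = m)
    (hA : ∀ W ∈ 𝓑, ∀ J ∈ F, IsLargestSparse q (𝒞 J) W (A W J))
    {p : ℝ} (hp : 0 < p) (hF : ¬ PSmall F p) :
    (#𝓑 : ℝ) < (Fintype.card V).choose m *
      (2 * ∑ t ∈ Finset.Icc 1 (Fintype.card V),
        ((2 : ℝ) ^ q * (Fintype.card V : ℝ) * p / (m : ℝ)) ^ t) := by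
  set n := Fintype.card V with hn
  have hhalf : ∀ W ∈ 𝓑, 1 / 2 < ∑ T ∈ minimalFragments F (A W) W, p ^ #T := by
    intro W hW
    by_contra! hle
    refine hF ⟨_, fun I hI => exists_minimalFragment_subset hI ?_, hle⟩
    exact hsub I hI _ (hA W hW I hI).1.1
  have hfib : ∀ W ∈ 𝓑, ∑ T ∈ minimalFragments F (A W) W, p ^ #T =
      ∑ t ∈ Finset.Icc 1 n, (#{T ∈ minimalFragments F (A W) W | #T = t} : ℝ) * p ^ t := by
    intro W hW
    rw [← Finset.sum_fiberwise_of_maps_to (g := Finset.card) (t := Finset.Icc 1 n)]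
    · refine Finset.sum_congr rfl fun t _ => ?_
      rw [← nsmul_eq_mul, ← Finset.sum_const]
      exact Finset.sum_congr rfl fun T hT => by rw [(Finset.mem_filter.1 hT).2]
    · intro T hT
      obtain ⟨⟨J, hJ, rfl⟩, -⟩ := mem_minimalFragments.1 hT
      refine Finset.mem_Icc.2 ⟨?_, Finset.card_le_univ _⟩
      exact Nat.pos_of_mul_pos_left (Nat.zero_lt_of_lt (hA W hW J hJ).1.2)
  have hsum : (#𝓑 : ℝ) * (1 / 2) < ∑ W ∈ 𝓑, ∑ T ∈ minimalFragments F (A W) W, p ^ #T := by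
    rw [← nsmul_eq_mul, ← Finset.sum_const]
    exact Finset.sum_lt_sum_of_nonempty hne hhalf
  rw [Finset.sum_congr rfl hfib, Finset.sum_comm] at hsum
  have hbound : ∑ t ∈ Finset.Icc 1 n, ∑ W ∈ 𝓑,
      (#{T ∈ minimalFragments F (A W) W | #T = t} : ℝ) * p ^ t ≤
      ∑ t ∈ Finset.Icc 1 n, n.choose m * ((2 : ℝ) ^ q * n * p / m) ^ t := by
    refine Finset.sum_le_sum fun t _ => ?_
    rw [← Finset.sum_mul]
    have h := sum_card_minimalFragments_le hchain h𝓑 hA t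
    have h' : ∑ W ∈ 𝓑, (#{T ∈ minimalFragments F (A W) W | #T = t} : ℝ) ≤
        (2 ^ (q * t) : ℝ) * n.choose (m + t) := by exact_mod_cast h
    calc _ ≤ (2 ^ (q * t) : ℝ) * (n.choose m * ((n : ℝ) / m) ^ t) * p ^ t := by
          gcongr
          exact h'.trans (by gcongr; exact choose_add_le_mul_div_pow n m t hm)
      _ = _ := by
          rw [pow_mul, mul_div_right_comm, mul_div_assoc, mul_pow, mul_pow]; ring
  rw [← Finset.mul_sum] at hbound
  linarith

/-- For every positive integer `r` there is a `C > 0` such that: for every finite `V`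
with `|V| = n`, every increasing `F ⊆ 2^V`, weights `μ_I : I → [0,∞)` (for `I ∈ F`) with
`∑_{v ∈ I} μ_I v = 1`, every `p ∈ (0,1]` such that `F` is not `p`-small, and every
`1 ≤ m ≤ n`, a uniformly random `m`-subset `W` of `V` is `(1 - 1/(2r))`-bad (i.e.
`∑_{v ∈ W ∩ I} μ_I v < 1 - 1/(2r)` for all `I ∈ F`) with probability strictly less than
`2 ∑_{t=1}^n (Cnp/m)^t`. -/
theorem bad_probability_bound (r : ℕ) (hr : 0 < r) :
    ∃ C : ℝ, 0 < C ∧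
      ∀ (V : Type) [Fintype V] [DecidableEq V] (F : Finset (Finset V)),
        Increasing F →
        ∀ μ : Finset V → V → ℝ,
          (∀ I ∈ F, (∀ v, 0 ≤ μ I v) ∧ ∑ v ∈ I, μ I v = 1) →
          ∀ p : ℝ, 0 < p → p ≤ 1 → ¬ PSmall F p →
          ∀ m : ℕ, 1 ≤ m → m ≤ Fintype.card V →
            (((Finset.powersetCard m (Finset.univ : Finset V)).filter
                (fun W => ∀ I ∈ F, ∑ v ∈ W ∩ I, μ I v < 1 - 1 / (2 * (r : ℝ)))).card : ℝ)
                / ((Fintype.card V).choose m : ℝ)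
              < 2 * ∑ t ∈ Finset.Icc 1 (Fintype.card V),
                  (C * (Fintype.card V : ℝ) * p / (m : ℝ)) ^ t := by
  refine ⟨2 ^ (2 * r), by positivity, ?_⟩
  intro V _ _ F _ μ hμ p hp _ hF m hm hmn
  have hchoose : (0 : ℝ) < (Fintype.card V).choose m := by exact_mod_cast Nat.choose_pos hmn
  have hm' : (0 : ℝ) < m := by exact_mod_cast hm
  have hn : (0 : ℝ) < Fintype.card V := by exact_mod_cast hm.trans hmn
  set 𝓑 := (Finset.powersetCard m (Finset.univ : Finset V)).filter
    (fun W => ∀ I ∈ F, ∑ v ∈ W ∩ I, μ I v < 1 - 1 / (2 * (r : ℝ))) with h𝓑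
  rw [div_lt_iff₀' hchoose]
  rcases 𝓑.eq_empty_or_nonempty with he | hne
  · rw [he, Finset.card_empty, Nat.cast_zero]
    refine mul_pos hchoose (mul_pos two_pos (Finset.sum_pos (fun t _ => by positivity) ?_))
    exact ⟨1, Finset.mem_Icc.2 ⟨le_rfl, hm.trans hmn⟩⟩
  let 𝒞 : Finset V → Finset (Finset V) := fun J => J.image fun x => {v ∈ J | μ J x ≤ μ J v}
  have hA : ∀ W ∈ 𝓑, ∀ J ∈ F, ∃ A, IsLargestSparse (2 * r) (𝒞 J) W A := by
    intro W hW J hJ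
    obtain ⟨x, hx, hlt⟩ := exists_superlevel_card_lt (μ J) (hμ J hJ).1 J W (hμ J hJ).2 (2 * r)
      (by omega) (by push_cast; exact (Finset.mem_filter.1 hW).2 J hJ)
    exact exists_isLargestSparse ⟨_, Finset.mem_image_of_mem _ hx, hlt⟩
  choose! A hA using hA
  refine card_lt_of_isLargestSparse (𝒞 := 𝒞) hm hne (fun J _ => ?_) (fun J _ => ?_)
    (fun W hW => (Finset.mem_powersetCard.1 (Finset.mem_filter.1 hW).1).2) hA hp hF
  · intro A hA B hB
    obtain ⟨x, -, rfl⟩ := Finset.mem_image.1 hA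
    obtain ⟨y, -, rfl⟩ := Finset.mem_image.1 hB
    rcases le_total (μ J x) (μ J y) with h | h
    · exact Or.inr (Finset.monotone_filter_right _ fun v _ hv => h.trans hv)
    · exact Or.inl (Finset.monotone_filter_right _ fun v _ hv => h.trans hv)
  · intro A hA
    obtain ⟨x, -, rfl⟩ := Finset.mem_image.1 hA
    exact Finset.filter_subset _ _
end

section
/- Let r be a positive integer, J > 0, p ∈ (0,1], and let V be a finite set with |V| = n ≥ 1. Let λ : 2^V → [0,∞) be supported on nonempty sets of size at most r and satisfy Σ_{S ⊆ V} λ(S) (Jp)^{|S|} ≤ 1/2. Let m be an integer with 1 ≤ m ≤ n and m/n ≤ Jp/(2r), and let X be a uniformly random m-element subset of V. Then with probability at least 1/2, Σ_{S ⊆ X} λ(S) ≤ 1/(2r). -/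
open Finset
open scoped Classical

theorem descFactorial_mul_pow_le {m n : ℕ} (h : m ≤ n) (s : ℕ) :
    m.descFactorial s * n ^ s ≤ n.descFactorial s * m ^ s := by
  induction s with
  | zero => simp
  | succ s ih =>
    have hstep : (m - s) * n ≤ (n - s) * m := by
      rw [Nat.sub_mul, Nat.sub_mul, Nat.mul_comm n m]
      exact Nat.sub_le_sub_left (Nat.mul_le_mul_left s h) _
    calc m.descFactorial (s + 1) * n ^ (s + 1)
        = ((m - s) * n) * (m.descFactorial s * n ^ s) := by
          rw [Nat.descFactorial_succ]; ring
      _ ≤ ((n - s) * m) * (n.descFactorial s * m ^ s) := Nat.mul_le_mul hstep ih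
      _ = n.descFactorial (s + 1) * m ^ (s + 1) := by
          rw [Nat.descFactorial_succ]; ring

theorem choose_mul_pow_le {m n : ℕ} (h : m ≤ n) (s : ℕ) :
    m.choose s * n ^ s ≤ n.choose s * m ^ s := by
  have := descFactorial_mul_pow_le h s
  rw [Nat.descFactorial_eq_factorial_mul_choose, Nat.descFactorial_eq_factorial_mul_choose,
    mul_assoc, mul_assoc] at this
  exact Nat.le_of_mul_le_mul_left this s.factorial_pos

/-- The number of `m`-subsets containing `S` is at most `(m / n) ^ |S|` times the number of all
`m`-subsets. -/
theorem card_filter_superset_mul_pow_le {V : Type*} [Fintype V] [DecidableEq V] (S : Finset V)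
    {m : ℕ} (hm : m ≤ Fintype.card V) :
    ((powersetCard m (univ : Finset V)).filter (S ⊆ ·)).card * Fintype.card V ^ S.card
      ≤ (Fintype.card V).choose m * m ^ S.card := by
  by_cases hs : S.card ≤ m
  · have hcount : ((powersetCard m (univ : Finset V)).filter (S ⊆ ·)).card
        ≤ (Fintype.card V - S.card).choose (m - S.card) := by
      rw [← card_compl, ← card_powersetCard]
      refine card_le_card_of_injOn (· \ S) ?_ ?_
      · intro X hX
        simp only [coe_filter, mem_powersetCard, Set.mem_ofPred_eq] at hX
        simp only [mem_coe, mem_powersetCard]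
        refine ⟨fun x hx => mem_compl.2 (mem_sdiff.1 hx).2, ?_⟩
        rw [card_sdiff_of_subset hX.2, hX.1.2]
      · intro X hX Y hY hXY
        simp only [coe_filter, Set.mem_ofPred_eq] at hX hY
        rw [← sdiff_union_of_subset hX.2, ← sdiff_union_of_subset hY.2]
        exact congrArg (· ∪ S) hXY
    have hpos : 0 < (Fintype.card V).choose S.card := Nat.choose_pos (card_le_univ S)
    refine (Nat.mul_le_mul_right _ hcount).trans (Nat.le_of_mul_le_mul_left ?_ hpos)
    calc _ = ((Fintype.card V).choose m * m.choose S.card) * Fintype.card V ^ S.card := by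
          rw [Nat.choose_mul hs, mul_assoc]
      _ = (Fintype.card V).choose m * (m.choose S.card * Fintype.card V ^ S.card) := mul_assoc ..
      _ ≤ (Fintype.card V).choose m * ((Fintype.card V).choose S.card * m ^ S.card) :=
          Nat.mul_le_mul_left _ (choose_mul_pow_le hm _)
      _ = _ := by ring
  · rw [filter_eq_empty_iff.2, card_empty, Nat.zero_mul]
    · exact Nat.zero_le _
    · intro X hX hSX
      exact hs ((card_le_card hSX).trans (mem_powersetCard.1 hX).2.le)

/-- Markov's inequality for a finite sum: if the average of `f` is at most `a / 2`, then
`f ≤ a` on at least half of the points. -/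
theorem half_card_le_card_filter_le {α : Type*} (A : Finset α) (f : α → ℝ)
    (hf : ∀ x ∈ A, 0 ≤ f x) {a : ℝ} (ha : 0 < a) (h : ∑ x ∈ A, f x ≤ A.card * (a / 2)) :
    (A.card : ℝ) / 2 ≤ (A.filter (fun x => f x ≤ a)).card := by
  have hbad : ((A.filter (fun x => ¬ f x ≤ a)).card : ℝ) * a ≤ ∑ x ∈ A, f x := by
    rw [← nsmul_eq_mul]
    refine (card_nsmul_le_sum _ f a fun x hx => (not_le.1 (mem_filter.1 hx).2).le).trans ?_
    exact sum_le_sum_of_subset_of_nonneg (filter_subset _ _) fun x hx _ => hf x hx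
  have hcard : ((A.filter (fun x => f x ≤ a)).card : ℝ)
      + (A.filter (fun x => ¬ f x ≤ a)).card = A.card := by
    exact_mod_cast card_filter_add_card_filter_not (s := A) (fun x => f x ≤ a)
  have : ((A.filter (fun x => ¬ f x ≤ a)).card : ℝ) ≤ A.card / 2 :=
    le_of_mul_le_mul_right (by linarith) ha
  linarith

/-- Let `r ≥ 1`, `J > 0`, `p ∈ (0,1]`, and `V` finite with `|V| = n ≥ 1`. Let
`λ : 2^V → [0,∞)` be supported on nonempty sets of size at most `r`, with
`∑_S λ S (Jp)^{|S|} ≤ 1/2`. Let `1 ≤ m ≤ n` with `m/n ≤ Jp/(2r)`, and let `X` be a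
uniformly random `m`-subset of `V`. Then `P(∑_{S ⊆ X} λ S ≤ 1/(2r)) ≥ 1/2`. -/
theorem prob_small_sum (r : ℕ) (hr : 0 < r) (J p : ℝ) (hJ : 0 < J)
    (hp : 0 < p) (hp1 : p ≤ 1)
    (V : Type) [Fintype V] [DecidableEq V] (hn : 1 ≤ Fintype.card V)
    (lam : Finset V → ℝ) (hlam0 : ∀ S, 0 ≤ lam S)
    (hempty : lam ∅ = 0) (hsupp : ∀ S : Finset V, r < S.card → lam S = 0)
    (hsum : ∑ S ∈ (Finset.univ : Finset V).powerset, lam S * (J * p) ^ S.card ≤ 1 / 2)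
    (m : ℕ) (hm1 : 1 ≤ m) (hm2 : m ≤ Fintype.card V)
    (hmn : (m : ℝ) / (Fintype.card V : ℝ) ≤ J * p / (2 * (r : ℝ))) :
    (1 : ℝ) / 2 ≤
      (((Finset.powersetCard m (Finset.univ : Finset V)).filter
          (fun X => ∑ S ∈ X.powerset, lam S ≤ 1 / (2 * (r : ℝ)))).card : ℝ)
        / ((Fintype.card V).choose m : ℝ) := by
  have hn0 : (0 : ℝ) < Fintype.card V := by exact_mod_cast hn
  have hr1 : (1 : ℝ) ≤ r := by exact_mod_cast hr
  have hC : (0 : ℝ) < (Fintype.card V).choose m := by exact_mod_cast Nat.choose_pos hm2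
  have hcard : (powersetCard m (univ : Finset V)).card = (Fintype.card V).choose m := by
    rw [card_powersetCard, card_univ]
  have hterm : ∀ S : Finset V,
      lam S * (((powersetCard m (univ : Finset V)).filter (S ⊆ ·)).card : ℝ)
        ≤ (Fintype.card V).choose m / (2 * r) * (lam S * (J * p) ^ S.card) := by
    intro S
    rcases S.eq_empty_or_nonempty with rfl | hS
    · simp [hempty]
    have hprob : (((powersetCard m (univ : Finset V)).filter (S ⊆ ·)).card : ℝ)
        ≤ (Fintype.card V).choose m * ((m : ℝ) / Fintype.card V) ^ S.card := by
      rw [div_pow, ← mul_div_assoc, le_div_iff₀ (by positivity)]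
      exact_mod_cast card_filter_superset_mul_pow_le S hm2
    have hpow : ((m : ℝ) / Fintype.card V) ^ S.card ≤ (J * p) ^ S.card / (2 * r) := by
      refine (pow_le_pow_left₀ (by positivity) hmn _).trans ?_
      rw [div_pow]
      gcongr
      exact le_self_pow₀ (by linarith) hS.card_pos.ne'
    calc _ ≤ lam S * ((Fintype.card V).choose m * ((J * p) ^ S.card / (2 * r))) :=
          mul_le_mul_of_nonneg_left
            (hprob.trans (mul_le_mul_of_nonneg_left hpow hC.le)) (hlam0 S)
      _ = _ := by ring
  have hmean : ∑ X ∈ powersetCard m (univ : Finset V), ∑ S ∈ X.powerset, lam S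
      ≤ (powersetCard m (univ : Finset V)).card * (1 / (2 * (r : ℝ)) / 2) := by
    calc _ = ∑ S ∈ (univ : Finset V).powerset,
          ∑ X ∈ (powersetCard m (univ : Finset V)).filter (S ⊆ ·), lam S :=
          sum_comm' fun X S => by simp [and_comm]
      _ = ∑ S ∈ (univ : Finset V).powerset,
          lam S * (((powersetCard m (univ : Finset V)).filter (S ⊆ ·)).card : ℝ) :=
          sum_congr rfl fun S _ => by rw [sum_const, nsmul_eq_mul, mul_comm]
      _ ≤ (Fintype.card V).choose m / (2 * r)
          * ∑ S ∈ (univ : Finset V).powerset, lam S * (J * p) ^ S.card := by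
          rw [mul_sum]
          exact sum_le_sum fun S _ => hterm S
      _ ≤ (Fintype.card V).choose m / (2 * r) * (1 / 2) :=
          mul_le_mul_of_nonneg_left hsum (by positivity)
      _ = _ := by rw [hcard]; ring
  have hmarkov := half_card_le_card_filter_le _ _
    (fun X _ => sum_nonneg fun S _ => hlam0 S) (by positivity) hmean
  rw [hcard] at hmarkov
  rw [le_div_iff₀ hC]
  linarith
end

section
/- Let r be a positive integer and V a finite set. Let λ : 2^V → [0,∞) be supported on nonempty sets of size at most r. Let I ⊆ V satisfy ν_I := Σ_{S ⊆ I} |S| λ(S) ≥ 1, and define μ_I : I → [0,∞) by μ_I(v) = ν_I^{−1} Σ_{S : v ∈ S ⊆ I} λ(S). Then for every Y ⊆ V, Σ_{v ∈ Y ∩ I} μ_I(v) ≤ 1 − 1/r + Σ_{S ⊆ Y ∩ I} λ(S). -/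
open Finset

/-- Summing over the points of `J` counts each `S` with multiplicity `#(S ∩ J)`. -/
theorem sum_sum_filter_mem_eq_sum_card_inter {V : Type*} [DecidableEq V]
    (f : Finset V → ℝ) (𝒜 : Finset (Finset V)) (J : Finset V) :
    ∑ v ∈ J, ∑ S ∈ 𝒜.filter (fun S => v ∈ S), f S = ∑ S ∈ 𝒜, ((S ∩ J).card : ℝ) * f S := by
  simp_rw [sum_filter]
  rw [sum_comm]
  refine sum_congr rfl fun S _ => ?_
  rw [← sum_filter, sum_const, nsmul_eq_mul, filter_mem_eq_inter, inter_comm]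

/-- A set of size at most `r` either lies inside `J` or misses at least a `1 / r` fraction
of its points there. -/
theorem card_inter_le_of_card_le {V : Type*} [DecidableEq V] {r : ℕ}
    {S : Finset V} (hS : S.card ≤ r) (J : Finset V) :
    ((S ∩ J).card : ℝ) ≤ (1 - 1 / (r : ℝ)) * S.card + if S ⊆ J then 1 else 0 := by
  have hdiv : (S.card : ℝ) / r ≤ 1 :=
    div_le_one_of_le₀ (by exact_mod_cast hS) (Nat.cast_nonneg r)
  have hexpand : (1 - 1 / (r : ℝ)) * S.card = S.card - S.card / r := by ring
  rw [hexpand]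
  split_ifs with h
  · rw [inter_eq_left.mpr h]
    linarith
  · have hlt : (S ∩ J).card < S.card :=
      card_lt_card (inter_subset_left.ssubset_of_ne fun he => h (inter_eq_left.mp he))
    have hle : ((S ∩ J).card : ℝ) + 1 ≤ S.card := by exact_mod_cast hlt
    linarith

/-- Let `r ≥ 1`, `V` finite, and `λ : 2^V → [0,∞)` supported on nonempty sets of size
at most `r`. Let `I ⊆ V` with `ν_I := ∑_{S ⊆ I} |S| λ S ≥ 1`, and define
`μ_I v = ν_I⁻¹ ∑_{v ∈ S ⊆ I} λ S`. Then for every `Y ⊆ V`,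
`∑_{v ∈ Y ∩ I} μ_I v ≤ 1 - 1/r + ∑_{S ⊆ Y ∩ I} λ S`. -/
theorem mu_bound (r : ℕ) (hr : 0 < r) (V : Type) [Fintype V] [DecidableEq V]
    (lam : Finset V → ℝ) (hlam0 : ∀ S, 0 ≤ lam S)
    (hempty : lam ∅ = 0) (hsupp : ∀ S : Finset V, r < S.card → lam S = 0)
    (I : Finset V) (hnu : 1 ≤ ∑ S ∈ I.powerset, (S.card : ℝ) * lam S)
    (Y : Finset V) :
    ∑ v ∈ Y ∩ I,
        (∑ S ∈ I.powerset, (S.card : ℝ) * lam S)⁻¹ *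
          ∑ S ∈ I.powerset.filter (fun S => v ∈ S), lam S
      ≤ 1 - 1 / (r : ℝ) + ∑ S ∈ (Y ∩ I).powerset, lam S := by
  set ν := ∑ S ∈ I.powerset, (S.card : ℝ) * lam S
  have hbound : ∑ S ∈ I.powerset, ((S ∩ (Y ∩ I)).card : ℝ) * lam S
      ≤ (1 - 1 / (r : ℝ)) * ν + ∑ S ∈ (Y ∩ I).powerset, lam S := by
    have hfilter : I.powerset.filter (fun S => S ⊆ Y ∩ I) = (Y ∩ I).powerset := by
      ext S
      simp only [mem_filter, mem_powerset, and_iff_right_iff_imp]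
      exact fun h => h.trans inter_subset_right
    rw [← hfilter, sum_filter, mul_sum, ← sum_add_distrib]
    refine sum_le_sum fun S _ => ?_
    rcases le_or_gt S.card r with hS | hS
    · have := mul_le_mul_of_nonneg_right (card_inter_le_of_card_le hS (Y ∩ I)) (hlam0 S)
      rwa [add_mul, mul_assoc, ite_mul, one_mul, zero_mul] at this
    · simp [hsupp S hS]
  have hsum : 0 ≤ ∑ S ∈ (Y ∩ I).powerset, lam S := sum_nonneg fun S _ => hlam0 S
  rw [← mul_sum, sum_sum_filter_mem_eq_sum_card_inter, inv_mul_le_iff₀ (by linarith)]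
  linarith [le_mul_of_one_le_left hsum hnu]
end

section
/- Let r be a positive integer, J > 0, p ∈ (0,1], and let V be a finite set with |V| = n ≥ 1. Let F ⊆ 2^V be a family and let λ : 2^V → [0,∞) be supported on nonempty sets of size at most r with Σ_{S ⊆ I} λ(S) ≥ 1 for every I ∈ F and Σ_{S ⊆ V} λ(S) (Jp)^{|S|} ≤ 1/2. For each I ∈ F set ν_I = Σ_{S ⊆ I} |S| λ(S) and define μ_I : I → [0,∞) by μ_I(v) = ν_I^{−1} Σ_{S : v ∈ S ⊆ I} λ(S). Let m be an integer with 1 ≤ m ≤ n and m/n ≤ Jp/(2r), and let X be a uniformly random m-element subset of V. Then with probability at least 1/2, X is (1 − 1/(2r))-bad with respect to the weights (μ_I)_{I ∈ F}, i.e., Σ_{v ∈ X ∩ I} μ_I(v) < 1 − 1/(2r) for every I ∈ F. (In fact, with probability at least 1/2, sup_{I ∈ F} Σ_{v ∈ X ∩ I} μ_I(v) ≤ 1 − 1/(2r).) -/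
open Finset
open scoped Classical

namespace RandomSubset

theorem descFactorial_mul_pow_le {m n : ℕ} (h : m ≤ n) (s : ℕ) :
    m.descFactorial s * n ^ s ≤ m ^ s * n.descFactorial s := by
  induction s with
  | zero => simp
  | succ s ih =>
    have key : (m - s) * n ≤ m * (n - s) := by
      rw [Nat.sub_mul, Nat.mul_sub]
      have := Nat.mul_le_mul_right s h
      rw [Nat.mul_comm n s] at this
      omega
    calc m.descFactorial (s + 1) * n ^ (s + 1)
        = ((m - s) * n) * (m.descFactorial s * n ^ s) := by
          rw [Nat.descFactorial_succ]; ring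
      _ ≤ (m * (n - s)) * (m ^ s * n.descFactorial s) := Nat.mul_le_mul key ih
      _ = m ^ (s + 1) * n.descFactorial (s + 1) := by
          rw [Nat.descFactorial_succ]; ring

theorem choose_mul_pow_le {m n : ℕ} (h : m ≤ n) (s : ℕ) :
    m.choose s * n ^ s ≤ m ^ s * n.choose s := by
  have := descFactorial_mul_pow_le h s
  rw [Nat.descFactorial_eq_factorial_mul_choose, Nat.descFactorial_eq_factorial_mul_choose] at this
  refine Nat.le_of_mul_le_mul_left ?_ (Nat.factorial_pos s)
  calc _ = s.factorial * m.choose s * n ^ s := by ring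
    _ ≤ _ := this
    _ = _ := by ring

variable {V : Type*} [DecidableEq V]

/-- A fixed set `S` is contained in a random `m`-subset with probability at most
`(m / n) ^ |S|`. -/
theorem card_supersets_le_pow_mul_choose [Fintype V] (hn : 0 < Fintype.card V) {m : ℕ}
    (hm : m ≤ Fintype.card V) (S : Finset V) :
    (((powersetCard m (univ : Finset V)).filter (fun X => S ⊆ X)).card : ℝ)
      ≤ ((m : ℝ) / Fintype.card V) ^ S.card * (Fintype.card V).choose m := by
  by_cases hS : S.card ≤ m
  · have h1 : ((powersetCard m (univ : Finset V)).filter (fun X => S ⊆ X)).card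
        = (Fintype.card V - S.card).choose (m - S.card) :=
      card_filter_powersetCard_subset S univ m (subset_univ S) hS
    have h2 := Nat.choose_mul (n := Fintype.card V) hS
    have h3 := choose_mul_pow_le hm S.card
    have hpos : 0 < (Fintype.card V).choose S.card := Nat.choose_pos (hS.trans hm)
    rw [div_pow, div_mul_eq_mul_div, le_div_iff₀ (by positivity)]
    norm_cast
    rw [h1]
    refine Nat.le_of_mul_le_mul_left ?_ hpos
    calc (Fintype.card V).choose S.card *
          ((Fintype.card V - S.card).choose (m - S.card) * Fintype.card V ^ S.card)
        = (Fintype.card V).choose m * (m.choose S.card * Fintype.card V ^ S.card) := by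
          rw [← mul_assoc, ← h2, mul_assoc]
      _ ≤ (Fintype.card V).choose m * (m ^ S.card * (Fintype.card V).choose S.card) := by
          gcongr
      _ = _ := by ring
  · rw [filter_false_of_mem]
    · simp only [card_empty, Nat.cast_zero]
      positivity
    · intro X hX hSX
      exact hS ((card_le_card hSX).trans_eq (mem_powersetCard.mp hX).2)

/-- If `X` carries at least a `1 - 1/(2r)` fraction of the weight induced on `I` by a
fractional cover, then the sets contained in `X` have total weight at least `1/2`. -/
theorem half_le_sum_powerset {r : ℕ} (hr : 0 < r) {lam : Finset V → ℝ}
    (hlam0 : ∀ S, 0 ≤ lam S) (hempty : lam ∅ = 0)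
    (hsupp : ∀ S : Finset V, r < S.card → lam S = 0) {I X : Finset V}
    (hcov : 1 ≤ ∑ S ∈ I.powerset, lam S)
    (hX : 1 - 1 / (2 * (r : ℝ)) ≤ ∑ v ∈ X ∩ I,
      (∑ S ∈ I.powerset, (S.card : ℝ) * lam S)⁻¹ *
        ∑ S ∈ I.powerset.filter (fun S => v ∈ S), lam S) :
    1 / 2 ≤ ∑ S ∈ X.powerset, lam S := by
  have hr' : (0 : ℝ) < r := by exact_mod_cast hr
  set ν := ∑ S ∈ I.powerset, (S.card : ℝ) * lam S with hν
  set L := ∑ S ∈ I.powerset, lam S with hL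
  have hνL : L ≤ ν := by
    refine sum_le_sum fun S _ => ?_
    rcases S.eq_empty_or_nonempty with rfl | hS
    · simp [hempty]
    · have : (1 : ℝ) ≤ S.card := by exact_mod_cast hS.card_pos
      nlinarith [hlam0 S]
  have hνr : ν ≤ r * L := by
    rw [hν, hL, mul_sum]
    refine sum_le_sum fun S _ => ?_
    by_cases hS : r < S.card
    · simp [hsupp S hS]
    · have : (S.card : ℝ) ≤ r := by exact_mod_cast not_lt.mp hS
      exact mul_le_mul_of_nonneg_right this (hlam0 S)
  have hν0 : 0 < ν := by linarith
  have hswap : ∑ v ∈ X ∩ I, ∑ S ∈ I.powerset.filter (fun S => v ∈ S), lam S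
      = ∑ S ∈ I.powerset, ((S ∩ X).card : ℝ) * lam S := by
    simp_rw [sum_filter]
    rw [sum_comm]
    refine sum_congr rfl fun S hS => ?_
    rw [← sum_filter, sum_const, nsmul_eq_mul]
    congr 3
    ext v
    have hSI : v ∈ S → v ∈ I := fun hv => mem_powerset.mp hS hv
    simp only [mem_filter, mem_inter]
    tauto
  rw [← mul_sum, hswap, inv_mul_eq_div, le_div_iff₀ hν0] at hX
  have hmiss : ∑ S ∈ I.powerset, ((S.card : ℝ) - (S ∩ X).card) * lam S ≤ L / 2 := by
    simp_rw [sub_mul]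
    rw [sum_sub_distrib, ← hν]
    have : 1 / (2 * (r : ℝ)) * ν ≤ L / 2 := by
      rw [one_div_mul_eq_div, div_le_iff₀ (by positivity)]
      linarith
    linarith
  have hout : ∑ S ∈ I.powerset.filter (fun S => ¬ S ⊆ X), lam S
      ≤ ∑ S ∈ I.powerset, ((S.card : ℝ) - (S ∩ X).card) * lam S := by
    rw [sum_filter]
    refine sum_le_sum fun S _ => ?_
    split_ifs with h
    · have : ((S ∩ X).card : ℝ) ≤ S.card := by exact_mod_cast card_le_card inter_subset_left
      exact mul_nonneg (by linarith) (hlam0 S)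
    · have hlt : (S ∩ X).card < S.card :=
        card_lt_card (inter_subset_left.ssubset_of_ne (fun h' => h (inter_eq_left.mp h')))
      have : ((S ∩ X).card : ℝ) + 1 ≤ S.card := by exact_mod_cast hlt
      nlinarith [hlam0 S]
  have hin : ∑ S ∈ I.powerset.filter (fun S => S ⊆ X), lam S ≤ ∑ S ∈ X.powerset, lam S :=
    sum_le_sum_of_subset_of_nonneg
      (fun S hS => mem_powerset.mpr (mem_filter.mp hS).2) (fun S _ _ => hlam0 S)
  have hsplit := sum_filter_add_sum_filter_not I.powerset (fun S => S ⊆ X) lam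
  linarith

/-- A random `m`-subset `X` has `∑ S ⊆ X, lam S ≥ 1/2` with probability at most `1/2`. -/
theorem card_half_le_sum_powerset_le [Fintype V] {r : ℕ} (hr : 0 < r) {q : ℝ} (hq : 0 ≤ q)
    (hn : 0 < Fintype.card V) {lam : Finset V → ℝ} (hlam0 : ∀ S, 0 ≤ lam S)
    (hempty : lam ∅ = 0) (hsum : ∑ S, lam S * q ^ S.card ≤ 1 / 2)
    {m : ℕ} (hm : m ≤ Fintype.card V) (hmn : (m : ℝ) / Fintype.card V ≤ q / (2 * r)) :
    (((powersetCard m (univ : Finset V)).filter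
        (fun X => 1 / 2 ≤ ∑ S ∈ X.powerset, lam S)).card : ℝ)
      ≤ 1 / 2 * (Fintype.card V).choose m := by
  set P := powersetCard m (univ : Finset V)
  have hr' : (1 : ℝ) ≤ r := by exact_mod_cast hr
  have hmarkov : ((P.filter (fun X => 1 / 2 ≤ ∑ S ∈ X.powerset, lam S)).card : ℝ) * (1 / 2)
      ≤ ∑ X ∈ P, ∑ S ∈ X.powerset, lam S := by
    rw [← nsmul_eq_mul]
    refine (card_nsmul_le_sum _ _ _ fun X hX => (mem_filter.mp hX).2).trans ?_
    exact sum_le_sum_of_subset_of_nonneg (filter_subset _ _)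
      (fun X _ _ => sum_nonneg fun S _ => hlam0 S)
  have hswap : ∑ X ∈ P, ∑ S ∈ X.powerset, lam S
      = ∑ S, lam S * ((P.filter (fun X => S ⊆ X)).card : ℝ) := by
    have h : ∀ X : Finset V, ∑ S ∈ X.powerset, lam S = ∑ S, if S ⊆ X then lam S else 0 := by
      intro X
      rw [← sum_filter]
      exact sum_congr (by ext S; simp) fun _ _ => rfl
    simp_rw [h]
    rw [sum_comm]
    refine sum_congr rfl fun S _ => ?_
    rw [← sum_filter, sum_const, nsmul_eq_mul, mul_comm]
  have hterm : ∀ S, lam S * ((P.filter (fun X => S ⊆ X)).card : ℝ)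
      ≤ (lam S * q ^ S.card) * (1 / 2 * (Fintype.card V).choose m) := by
    intro S
    rcases S.eq_empty_or_nonempty with rfl | hS
    · simp [hempty]
    have hle : (m : ℝ) / Fintype.card V ≤ q * (1 / 2) := by
      refine hmn.trans ?_
      rw [div_eq_mul_one_div]
      gcongr
      linarith
    have hhalf : ((1 : ℝ) / 2) ^ S.card ≤ 1 / 2 :=
      pow_le_of_le_one (by norm_num) (by norm_num) hS.card_pos.ne'
    calc lam S * ((P.filter (fun X => S ⊆ X)).card : ℝ)
        ≤ lam S * (((m : ℝ) / Fintype.card V) ^ S.card * (Fintype.card V).choose m) :=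
          mul_le_mul_of_nonneg_left (card_supersets_le_pow_mul_choose hn hm S) (hlam0 S)
      _ ≤ lam S * ((q * (1 / 2)) ^ S.card * (Fintype.card V).choose m) := by
          have := hlam0 S
          gcongr
      _ = lam S * (q ^ S.card * ((1 / 2) ^ S.card * (Fintype.card V).choose m)) := by
          rw [mul_pow, mul_assoc]
      _ ≤ lam S * (q ^ S.card * (1 / 2 * (Fintype.card V).choose m)) := by
          have := hlam0 S
          gcongr
      _ = _ := by ring
  have htotal : ∑ S, lam S * ((P.filter (fun X => S ⊆ X)).card : ℝ)
      ≤ 1 / 2 * (1 / 2 * (Fintype.card V).choose m) := by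
    refine (sum_le_sum fun S _ => hterm S).trans ?_
    rw [← sum_mul]
    gcongr
  linarith

end RandomSubset

/-- Let `r ≥ 1`, `J > 0`, `p ∈ (0,1]`, and `V` finite with `|V| = n ≥ 1`. Let
`F ⊆ 2^V` and let `λ : 2^V → [0,∞)` be supported on nonempty sets of size at most `r`,
with `∑_{S ⊆ I} λ S ≥ 1` for every `I ∈ F` and `∑_S λ S (Jp)^{|S|} ≤ 1/2`. For `I ∈ F`,
set `ν_I = ∑_{S ⊆ I} |S| λ S` and `μ_I v = ν_I⁻¹ ∑_{v ∈ S ⊆ I} λ S`. Let `1 ≤ m ≤ n`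
with `m/n ≤ Jp/(2r)` and let `X` be a uniformly random `m`-subset of `V`. Then with
probability at least `1/2`, `X` is `(1 - 1/(2r))`-bad with respect to the `μ_I`'s,
i.e. `∑_{v ∈ X ∩ I} μ_I v < 1 - 1/(2r)` for every `I ∈ F`; and with probability at
least `1/2`, `sup_{I ∈ F} ∑_{v ∈ X ∩ I} μ_I v ≤ 1 - 1/(2r)`. -/
theorem prob_bad_at_least_half (r : ℕ) (hr : 0 < r) (J p : ℝ) (hJ : 0 < J)
    (hp : 0 < p) (hp1 : p ≤ 1)
    (V : Type) [Fintype V] [DecidableEq V] (hn : 1 ≤ Fintype.card V)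
    (F : Finset (Finset V))
    (lam : Finset V → ℝ) (hlam0 : ∀ S, 0 ≤ lam S)
    (hempty : lam ∅ = 0) (hsupp : ∀ S : Finset V, r < S.card → lam S = 0)
    (hcov : ∀ I ∈ F, 1 ≤ ∑ S ∈ I.powerset, lam S)
    (hsum : ∑ S ∈ (Finset.univ : Finset V).powerset, lam S * (J * p) ^ S.card ≤ 1 / 2)
    (m : ℕ) (hm1 : 1 ≤ m) (hm2 : m ≤ Fintype.card V)
    (hmn : (m : ℝ) / (Fintype.card V : ℝ) ≤ J * p / (2 * (r : ℝ))) :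
    (1 : ℝ) / 2 ≤
      (((Finset.powersetCard m (Finset.univ : Finset V)).filter
          (fun X => ∀ I ∈ F,
            ∑ v ∈ X ∩ I,
                (∑ S ∈ I.powerset, (S.card : ℝ) * lam S)⁻¹ *
                  ∑ S ∈ I.powerset.filter (fun S => v ∈ S), lam S
              < 1 - 1 / (2 * (r : ℝ)))).card : ℝ)
        / ((Fintype.card V).choose m : ℝ) ∧
    (1 : ℝ) / 2 ≤
      (((Finset.powersetCard m (Finset.univ : Finset V)).filter
          (fun X => ∀ I ∈ F,
            ∑ v ∈ X ∩ I,
                (∑ S ∈ I.powerset, (S.card : ℝ) * lam S)⁻¹ *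
                  ∑ S ∈ I.powerset.filter (fun S => v ∈ S), lam S
              ≤ 1 - 1 / (2 * (r : ℝ)))).card : ℝ)
        / ((Fintype.card V).choose m : ℝ) := by
  have hgood := RandomSubset.card_half_le_sum_powerset_le hr (mul_pos hJ hp).le hn hlam0 hempty
    (by simpa using hsum) hm2 hmn
  have hchoose : (0 : ℝ) < (Fintype.card V).choose m := by exact_mod_cast Nat.choose_pos hm2
  have hsplit := card_filter_add_card_filter_not (s := powersetCard m (univ : Finset V))
    (fun X => 1 / 2 ≤ ∑ S ∈ X.powerset, lam S)
  rw [card_powersetCard, card_univ] at hsplit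
  have hsplit' : (((powersetCard m (univ : Finset V)).filter
      (fun X => 1 / 2 ≤ ∑ S ∈ X.powerset, lam S)).card : ℝ)
      + ((powersetCard m (univ : Finset V)).filter
      (fun X => ¬ 1 / 2 ≤ ∑ S ∈ X.powerset, lam S)).card = (Fintype.card V).choose m := by
    exact_mod_cast hsplit
  have hbad : ∀ X : Finset V, ¬ 1 / 2 ≤ ∑ S ∈ X.powerset, lam S → ∀ I ∈ F,
      ∑ v ∈ X ∩ I, (∑ S ∈ I.powerset, (S.card : ℝ) * lam S)⁻¹ *
        ∑ S ∈ I.powerset.filter (fun S => v ∈ S), lam S < 1 - 1 / (2 * (r : ℝ)) := by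
    intro X hX I hI
    by_contra hcon
    exact hX (RandomSubset.half_le_sum_powerset hr hlam0 hempty hsupp (hcov I hI)
      (not_lt.mp hcon))
  refine ⟨?_, ?_⟩
  all_goals
    rw [le_div_iff₀ hchoose]
    refine le_trans (b := (((powersetCard m (univ : Finset V)).filter
      (fun X => ¬ 1 / 2 ≤ ∑ S ∈ X.powerset, lam S)).card : ℝ)) (by linarith) ?_
    refine Nat.cast_le.mpr (card_le_card (monotone_filter_right _ fun X _ hX I hI => ?_))
  · exact hbad X hX I hI
  · exact (hbad X hX I hI).le
end
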